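/- Let Y and Z be geodesic Polish metric spaces and assume Y is geodesically complete and locally compact. Then the quadratic Wasserstein space W₂(Y) is isometric to W₂(Z) if and only if Y is isometric to Z. -/

import Mathlib

open MeasureTheory Filter Set Topology
open scoped NNReal ENNReal

noncomputable section


/-! ## Geodesics and Hadamard spaces -/

/-- `γ` is a geodesic on the set of parameters `s`, of speed `v`, with respect to the
distance function `d`. -/
def IsGeodesicOnWith {A : Type*} (d : A → A → ℝ) (γ : ℝ → A) (s : Set ℝ) (v : ℝ) : Prop :=
  ∀ t ∈ s, ∀ t' ∈ s, d (γ t) (γ t') = v * |t - t'|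

/-- A metric space is geodesic if any two points are joined by a geodesic. -/
def IsGeodesicSpace (Y : Type*) [MetricSpace Y] : Prop :=
  ∀ x y : Y, ∃ γ : ℝ → Y, γ 0 = x ∧ γ 1 = y ∧
    IsGeodesicOnWith dist γ (Set.Icc (0:ℝ) 1) (dist x y)

/-- Every geodesic segment extends to a complete geodesic (defined on all of `ℝ`). -/
def GeodesicallyComplete (Y : Type*) [MetricSpace Y] : Prop :=
  ∀ (γ : ℝ → Y) (a b v : ℝ), a < b → IsGeodesicOnWith dist γ (Set.Icc a b) v →
    ∃ g : ℝ → Y, IsGeodesicOnWith dist g Set.univ v ∧ ∀ t ∈ Set.Icc a b, g t = γ t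

/-- A Hadamard space: complete, separable, locally compact, geodesic, globally CAT(0).
The CAT(0) comparison inequality is expressed through the explicit formula for the distance
from a vertex to a point of the opposite side in the Euclidean comparison triangle. -/
structure IsHadamard (X : Type*) [MetricSpace X] : Prop where
  complete : CompleteSpace X
  separable : TopologicalSpace.SeparableSpace X
  locallyCompact : LocallyCompactSpace X
  geodesic : IsGeodesicSpace X
  cat0 : ∀ (x y z : X) (γ : ℝ → X), γ 0 = y → γ 1 = z →
    IsGeodesicOnWith dist γ (Set.Icc (0:ℝ) 1) (dist y z) →
    ∀ t ∈ Set.Icc (0:ℝ) 1,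
      dist x (γ t) ^ 2 ≤ (1 - t) * dist x y ^ 2 + t * dist x z ^ 2 - t * (1 - t) * dist y z ^ 2

/-- A space is non-branching if two geodesics coinciding on a nonempty open set of parameters
coincide on their whole common interval of definition. -/
def NonBranching (X : Type*) [MetricSpace X] : Prop :=
  ∀ (γ β : ℝ → X) (I : Set ℝ) (v w : ℝ),
    IsGeodesicOnWith dist γ I v → IsGeodesicOnWith dist β I w →
    (∃ U : Set ℝ, U ⊆ I ∧ IsOpen U ∧ U.Nonempty ∧ ∀ t ∈ U, γ t = β t) →
    ∀ t ∈ I, γ t = β t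

/-! ## The Wasserstein space -/

/-- `π` is a coupling (transport plan) between `μ` and `ν`. -/
def IsCoupling {A B : Type*} [MeasurableSpace A] [MeasurableSpace B]
    (π : Measure (A × B)) (μ : Measure A) (ν : Measure B) : Prop :=
  π.map Prod.fst = μ ∧ π.map Prod.snd = ν

/-- The quadratic Wasserstein space over `Y`: Borel probability measures with finite second
moment. -/
abbrev W2Space (Y : Type*) [MetricSpace Y] [MeasurableSpace Y] : Type _ :=
  {μ : Measure Y // IsProbabilityMeasure μ ∧
    ∃ x₀ : Y, (∫⁻ x, ENNReal.ofReal (dist x₀ x) ^ 2 ∂μ) < ⊤}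

/-- The quadratic transport cost between two measures. -/
def W2cost {Y : Type*} [MetricSpace Y] [MeasurableSpace Y] (μ ν : Measure Y) : ℝ≥0∞ :=
  ⨅ (π : Measure (Y × Y)) (_ : IsCoupling π μ ν),
    ∫⁻ p, ENNReal.ofReal (dist p.1 p.2) ^ 2 ∂π

/-- The quadratic Wasserstein distance. -/
def Wdist {Y : Type*} [MetricSpace Y] [MeasurableSpace Y] (μ ν : W2Space Y) : ℝ :=
  Real.sqrt (W2cost μ.1 ν.1).toReal


/-! ## Rays, complete geodesics, the boundary at infinity and the cone over it -/

/-- Geodesic rays of `X` (arbitrary nonnegative speed), parametrized by `ℝ≥0`.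
The topology (of a subtype of a product) coincides on this set with the topology of
uniform convergence on compact sets. -/
abbrev RaySpace (X : Type*) [MetricSpace X] : Type _ :=
  {γ : ℝ≥0 → X // ∃ v : ℝ, 0 ≤ v ∧ ∀ s t : ℝ≥0, dist (γ s) (γ t) = v * dist s t}

/-- Unit speed geodesic rays of `X`. -/
abbrev UnitRay (X : Type*) [MetricSpace X] : Type _ :=
  {γ : ℝ≥0 → X // ∀ s t : ℝ≥0, dist (γ s) (γ t) = dist s t}

/-- Complete geodesics of `X` (arbitrary nonnegative speed). -/
abbrev GeoLine (X : Type*) [MetricSpace X] : Type _ :=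
  {γ : ℝ → X // ∃ v : ℝ, 0 ≤ v ∧ ∀ s t : ℝ, dist (γ s) (γ t) = v * |s - t|}

/-- Complete unit speed geodesics of `X`. -/
abbrev UnitLine (X : Type*) [MetricSpace X] : Type _ :=
  {γ : ℝ → X // ∀ s t : ℝ, dist (γ s) (γ t) = |s - t|}

/-- Evaluation of a ray at time `t`. -/
def rayEval {X : Type*} [MetricSpace X] (t : ℝ≥0) : RaySpace X → X := fun γ => γ.1 t

/-- Two curves (w.r.t. a distance function `d`) are asymptotic if they stay at bounded
distance. -/
def AsymptoticMaps {A : Type*} (d : A → A → ℝ) (γ β : ℝ≥0 → A) : Prop :=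
  ∃ C : ℝ, ∀ t, d (γ t) (β t) ≤ C

/-- The asymptote relation on unit-speed rays. -/
def unitRaySetoid (X : Type*) [MetricSpace X] : Setoid (UnitRay X) where
  r γ β := AsymptoticMaps dist γ.1 β.1
  iseqv := by
    refine ⟨fun γ => ⟨0, fun t => by simp⟩, ?_, ?_⟩
    · rintro γ β ⟨C, h⟩
      exact ⟨C, fun t => by rw [dist_comm]; exact h t⟩
    · rintro γ β δ ⟨C, h⟩ ⟨C', h'⟩
      exact ⟨C + C', fun t => (dist_triangle _ _ _).trans (add_le_add (h t) (h' t))⟩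

/-- The geodesic boundary of `X`: asymptote classes of unit-speed rays, with the quotient
topology of the topology of uniform convergence on compact sets (the cone topology). -/
abbrev Boundary (X : Type*) [MetricSpace X] := Quotient (unitRaySetoid X)

/-- Apex-like points, to be collapsed when forming the cone over `B`. -/
def coneIsApex {B : Type*} : B × ℝ≥0 ⊕ Unit → Prop
  | Sum.inl p => p.2 = 0
  | Sum.inr _ => True

/-- The relation collapsing all apex-like points. -/
def coneSetoid (B : Type*) : Setoid (B × ℝ≥0 ⊕ Unit) where
  r p q := p = q ∨ (coneIsApex p ∧ coneIsApex q)
  iseqv := by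
    refine ⟨fun p => Or.inl rfl, ?_, ?_⟩
    · rintro p q (rfl | h)
      · exact Or.inl rfl
      · exact Or.inr ⟨h.2, h.1⟩
    · rintro p q r (rfl | h) (rfl | h')
      · exact Or.inl rfl
      · exact Or.inr h'
      · exact Or.inr h
      · exact Or.inr ⟨h.1, h'.2⟩

/-- The cone over a space `B`: the quotient of `B × [0,∞)` collapsing the zero level to the
apex, with the quotient topology. -/
abbrev Cone (B : Type*) := Quotient (coneSetoid B)

/-- The point of the cone over `b` at height (speed) `s`. -/
def coneMk {B : Type*} (b : B) (s : ℝ≥0) : Cone B :=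
  Quotient.mk (coneSetoid B) (Sum.inl (b, s))

/-- The apex of the cone. -/
def conePt (B : Type*) : Cone B := Quotient.mk (coneSetoid B) (Sum.inr ())

private def coneSpeedAux {B : Type*} : B × ℝ≥0 ⊕ Unit → ℝ≥0
  | Sum.inl p => p.2
  | Sum.inr _ => 0

/-- The speed (radial) coordinate of a point of the cone. -/
def coneSpeed {B : Type*} : Cone B → ℝ≥0 :=
  Quotient.lift coneSpeedAux (by
    rintro p q (rfl | ⟨h1, h2⟩)
    · rfl
    · cases p <;> cases q <;> simp_all [coneIsApex, coneSpeedAux])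

/-- The speed of a geodesic ray. -/
def raySpeed {X : Type*} [MetricSpace X] (γ : RaySpace X) : ℝ≥0 :=
  nndist (γ.1 0) (γ.1 1)

lemma raySpeed_eq {X : Type*} [MetricSpace X] (γ : RaySpace X) {v : ℝ} (hv0 : 0 ≤ v)
    (hv : ∀ s t : ℝ≥0, dist (γ.1 s) (γ.1 t) = v * dist s t) : (raySpeed γ : ℝ) = v := by
  have h1 := hv 0 1
  have h2 : dist (0 : ℝ≥0) (1 : ℝ≥0) = 1 := by rw [NNReal.dist_eq]; norm_num
  rw [h2, mul_one] at h1
  rw [show (raySpeed γ : ℝ) = dist (γ.1 0) (γ.1 1) from (dist_nndist _ _).symm, h1]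

/-- The unit reparametrization of a nonconstant ray. -/
def rayUnit {X : Type*} [MetricSpace X] (γ : RaySpace X) (h : raySpeed γ ≠ 0) : UnitRay X := by
  refine ⟨fun t => γ.1 (t / raySpeed γ), ?_⟩
  obtain ⟨v, hv0, hv⟩ := γ.2
  have hveq : (raySpeed γ : ℝ) = v := raySpeed_eq γ hv0 hv
  intro s t
  have hr : (raySpeed γ : ℝ) ≠ 0 := by
    simpa using h
  show dist (γ.1 (s / raySpeed γ)) (γ.1 (t / raySpeed γ)) = dist s t
  rw [hv, NNReal.dist_eq, NNReal.dist_eq, NNReal.coe_div, NNReal.coe_div,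
    div_sub_div_same, abs_div, abs_of_nonneg (raySpeed γ).coe_nonneg, ← hveq]
  field_simp

/-- The point at infinity (in the cone over the boundary) defined by a geodesic ray:
its asymptote class together with its speed; constant rays are sent to the apex. -/
def rayEnd {X : Type*} [MetricSpace X] (γ : RaySpace X) : Cone (Boundary X) :=
  if h : raySpeed γ = 0 then conePt (Boundary X)
  else coneMk (Quotient.mk (unitRaySetoid X) (rayUnit γ h)) (raySpeed γ)

/-! ## Asymptotic distance -/

def dInfty {X : Type*} [MetricSpace X] (γ β : ℝ≥0 → X) : ℝ :=
  Filter.limsup (fun t : ℝ≥0 => dist (γ t) (β t) / (t : ℝ)) Filter.atTop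

/-- The asymptotic (angular) distance on the boundary, computed on representative rays
(it does not depend on the choice of representatives). -/
def boundaryDist {X : Type*} [MetricSpace X] (ξ ζ : Boundary X) : ℝ :=
  dInfty (ξ.out).1 (ζ.out).1

def coneDistAux {X : Type*} [MetricSpace X] :
    Boundary X × ℝ≥0 ⊕ Unit → Boundary X × ℝ≥0 ⊕ Unit → ℝ
  | Sum.inl p, Sum.inl q =>
      Real.sqrt (((p.2 : ℝ) - (q.2 : ℝ)) ^ 2 + (p.2 : ℝ) * (q.2 : ℝ) * boundaryDist p.1 q.1 ^ 2)
  | Sum.inl p, Sum.inr _ => p.2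
  | Sum.inr _, Sum.inl q => q.2
  | Sum.inr _, Sum.inr _ => 0

/-- The asymptotic distance on the cone over the boundary (the cone metric). -/
def coneDist {X : Type*} [MetricSpace X] : Cone (Boundary X) → Cone (Boundary X) → ℝ :=
  Quotient.lift₂ coneDistAux (by
    rintro a₁ a₂ b₁ b₂ h12 h34
    rcases h12 with rfl | ⟨h1, h2⟩ <;> rcases h34 with rfl | ⟨h3, h4⟩
    · rfl
    · rcases a₁ with p | u <;> rcases a₂ with q | v <;> rcases b₂ with q' | w <;>
        simp_all [coneIsApex, coneDistAux, Real.sqrt_sq, NNReal.coe_nonneg]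
    · rcases a₂ with q | u <;> rcases a₁ with p | v <;> rcases b₁ with p' | w <;>
        simp_all [coneIsApex, coneDistAux, Real.sqrt_sq, NNReal.coe_nonneg]
    · rcases a₁ with p | u <;> rcases a₂ with q | v <;> rcases b₁ with p' | w <;>
        rcases b₂ with q' | w' <;>
        simp_all [coneIsApex, coneDistAux, Real.sqrt_sq, NNReal.coe_nonneg])


-- Borel measurable structure on the boundary and the cone over it.
instance (X : Type*) [MetricSpace X] : MeasurableSpace (Boundary X) := borel _
instance (X : Type*) [MetricSpace X] : BorelSpace (Boundary X) := ⟨rfl⟩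
instance (X : Type*) [MetricSpace X] : MeasurableSpace (Cone (Boundary X)) := borel _
instance (X : Type*) [MetricSpace X] : BorelSpace (Cone (Boundary X)) := ⟨rfl⟩

/-- The Wasserstein metric `W_∞` on measures on the cone over the boundary, built from the
cost `d_∞²`. -/
def Winfty {X : Type*} [MetricSpace X] (m m' : Measure (Cone (Boundary X))) : ℝ :=
  Real.sqrt (⨅ (π : Measure (Cone (Boundary X) × Cone (Boundary X)))
    (_ : IsCoupling π m m'),
      ∫⁻ p, ENNReal.ofReal (coneDist p.1 p.2) ^ 2 ∂π).toReal


/-! ## Visibility -/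

/-- `X` is a visibility space: any two distinct boundary points are the two endpoints of a
complete geodesic. -/
def IsVisibility (X : Type*) [MetricSpace X] : Prop :=
  ∀ α ω : UnitRay X, ¬ AsymptoticMaps dist α.1 ω.1 →
    ∃ g : ℝ → X, (∀ s t : ℝ, dist (g s) (g t) = |s - t|) ∧
      AsymptoticMaps dist (fun t : ℝ≥0 => g (-(t : ℝ))) α.1 ∧
      AsymptoticMaps dist (fun t : ℝ≥0 => g (t : ℝ)) ω.1

/-! ## Curves, length, rectifiability -/

/-- The length of a curve with respect to a distance function `d`, as a supremum over
finite monotone sequences of parameters in `[a,b]`. -/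
def curveLengthWith {A : Type*} (d : A → A → ℝ) (c : ℝ → A) (a b : ℝ) : ℝ≥0∞ :=
  ⨆ (n : ℕ) (t : Fin (n + 1) → ℝ) (_ : Monotone t) (_ : ∀ i, t i ∈ Set.Icc a b),
    ∑ i : Fin n, ENNReal.ofReal (d (c (t i.castSucc)) (c (t i.succ)))

/-- Continuity of a curve with respect to a distance function `d`, on a set of parameters. -/
def ContinuousWithRespect {A : Type*} (d : A → A → ℝ) (c : ℝ → A) (s : Set ℝ) : Prop :=
  ∀ t ∈ s, ∀ ε : ℝ, 0 < ε → ∃ δ : ℝ, 0 < δ ∧ ∀ u ∈ s, |u - t| < δ → d (c u) (c t) < ε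

/-- `W_∞` between measures on the boundary, viewed as the level `{speed = 1}` of the cone,
with cost `d_∞²`. -/
def WinftyLevel1 {X : Type*} [MetricSpace X] (m m' : Measure (Boundary X)) : ℝ :=
  Real.sqrt (⨅ (π : Measure (Boundary X × Boundary X)) (_ : IsCoupling π m m'),
    ∫⁻ p, ENNReal.ofReal (coneDist (coneMk p.1 1) (coneMk p.2 1)) ^ 2 ∂π).toReal

/-! ## Support of a measure -/

/-- The (topological) support of a measure. -/
def msupport {A : Type*} [TopologicalSpace A] [MeasurableSpace A] (μ : Measure A) : Set A :=
  {x | ∀ U : Set A, x ∈ U → IsOpen U → 0 < μ U}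

/-! ## Cyclical monotonicity and antagonism -/

/-- A set `Γ` is `c`-cyclically monotone if no cyclic permutation of the target points of a
finite family of pairs of `Γ` decreases the total cost. -/
def CyclicallyMonotone {A : Type*} (c : A → A → ℝ) (Γ : Set (A × A)) : Prop :=
  ∀ (m : ℕ) (p : Fin (m + 1) → A × A), (∀ i, p i ∈ Γ) →
    (∑ i, c (p i).1 (p i).2) ≤ ∑ i, c (p i).1 (p (i + 1)).2

/-- Two curves are antagonist if they pass through two distinct points in opposite orders. -/
def Antagonist {X : Type*} (γ β : ℝ → X) : Prop :=
  ∃ x y : X, x ≠ y ∧ (∃ s t : ℝ, s < t ∧ γ s = x ∧ γ t = y) ∧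
    (∃ s t : ℝ, s < t ∧ β s = y ∧ β t = x)

/-! ## Negative curvature, trees -/

/-- Three points lying on a common geodesic. -/
def Aligned {X : Type*} [MetricSpace X] (x y z : X) : Prop :=
  dist x y + dist y z = dist x z ∨ dist y x + dist x z = dist y z ∨
    dist x z + dist z y = dist x y

/-- `X` is negatively curved: it is not a line, and the CAT(0) comparison inequality is
strict except for aligned triangles. -/
def IsNegativelyCurved (X : Type*) [MetricSpace X] : Prop :=
  (¬ ∃ f : ℝ → X, Function.Surjective f ∧ ∀ s t : ℝ, dist (f s) (f t) = |s - t|) ∧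
  ∀ (x y z : X) (γ : ℝ → X), γ 0 = y → γ 1 = z →
    IsGeodesicOnWith dist γ (Set.Icc (0:ℝ) 1) (dist y z) → ¬ Aligned x y z →
    ∀ t ∈ Set.Ioo (0:ℝ) 1,
      dist x (γ t) ^ 2 < (1 - t) * dist x y ^ 2 + t * dist x z ^ 2 - t * (1 - t) * dist y z ^ 2

/-- A metric tree (real tree): a geodesic space satisfying the four-point 0-hyperbolicity
condition. -/
def IsRealTree (X : Type*) [MetricSpace X] : Prop :=
  IsGeodesicSpace X ∧ ∀ x y z w : X,
    dist x y + dist z w ≤ max (dist x z + dist y w) (dist x w + dist y z)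

/-! ## Ends of complete geodesics -/

/-- The forward ray of a complete geodesic. -/
def lineForward {X : Type*} [MetricSpace X] (γ : GeoLine X) : RaySpace X :=
  ⟨fun t : ℝ≥0 => γ.1 (t : ℝ), by
    obtain ⟨v, hv0, hv⟩ := γ.2
    exact ⟨v, hv0, fun s t => by rw [hv, NNReal.dist_eq]⟩⟩

/-- The backward ray of a complete geodesic. -/
def lineBackward {X : Type*} [MetricSpace X] (γ : GeoLine X) : RaySpace X :=
  ⟨fun t : ℝ≥0 => γ.1 (-(t : ℝ)), by
    obtain ⟨v, hv0, hv⟩ := γ.2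
    refine ⟨v, hv0, fun s t => ?_⟩
    rw [hv, NNReal.dist_eq]
    congr 1
    rw [abs_sub_comm]
    congr 1
    ring⟩

/-- The end at `+∞` of a complete geodesic, in the cone over the boundary. -/
def lineEndPlus {X : Type*} [MetricSpace X] (γ : GeoLine X) : Cone (Boundary X) :=
  rayEnd (lineForward γ)

/-- The end at `-∞` of a complete geodesic, in the cone over the boundary. -/
def lineEndMinus {X : Type*} [MetricSpace X] (γ : GeoLine X) : Cone (Boundary X) :=
  rayEnd (lineBackward γ)

/-- `g` is a unit complete geodesic with ends `ξ` (at `-∞`) and `ζ` (at `+∞`). -/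
def LineConnects {X : Type*} [MetricSpace X] (g : ℝ → X) (ξ ζ : Boundary X) : Prop :=
  (∀ s t : ℝ, dist (g s) (g t) = |s - t|) ∧
  (∃ γ : UnitRay X, Quotient.mk (unitRaySetoid X) γ = ξ ∧
    AsymptoticMaps dist (fun u : ℝ≥0 => g (-(u : ℝ))) γ.1) ∧
  (∃ γ : UnitRay X, Quotient.mk (unitRaySetoid X) γ = ζ ∧
    AsymptoticMaps dist (fun u : ℝ≥0 => g (u : ℝ)) γ.1)

/-- Two boundary points are antipodal if they are joined by a complete geodesic. -/
def Antipodal {X : Type*} [MetricSpace X] (ξ ζ : Boundary X) : Prop :=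
  ∃ g : ℝ → X, LineConnects g ξ ζ

/-- Two measures on the boundary are antipodal if they are concentrated on antipodal sets. -/
def AntipodalMeasures {X : Type*} [MetricSpace X] (νm νp : Measure (Boundary X)) : Prop :=
  ∃ A B : Set (Boundary X), MeasurableSet A ∧ MeasurableSet B ∧ νm A = 1 ∧ νp B = 1 ∧
    ∀ ξ ∈ A, ∀ ζ ∈ B, Antipodal ξ ζ

/-- Two measures on the boundary are uniformly antipodal if their supports are antipodal. -/
def UniformlyAntipodal {X : Type*} [MetricSpace X] (νm νp : Measure (Boundary X)) : Prop :=
  ∀ ξ ∈ msupport νm, ∀ ζ ∈ msupport νp, Antipodal ξ ζ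

/-- The distance from the base point `x₀` to the geodesic line joining two boundary points
(for trees, the Gromov product). -/
def D0 {X : Type*} [MetricSpace X] (x₀ : X) (ξ ζ : Boundary X) : ℝ :=
  sInf {r : ℝ | ∃ g : ℝ → X, LineConnects g ξ ζ ∧ ∃ t : ℝ, r = dist x₀ (g t)}

/-- The unit geodesic from `ξ` to `ζ`, parametrized so that its time-`0` point is closest to
the base point `x₀`. -/
def lineFrom {X : Type*} [MetricSpace X] (x₀ : X) (ξ ζ : Boundary X) : ℝ → X :=
  haveI : Nonempty X := ⟨x₀⟩
  Classical.epsilon fun g : ℝ → X =>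
    LineConnects g ξ ζ ∧ dist x₀ (g 0) = D0 x₀ ξ ζ

/-! ## Flows on trees -/

/-- The set of boundary points whose rays eventually lie in `C`. -/
def compBdry {X : Type*} [MetricSpace X] (C : Set X) : Set (Boundary X) :=
  {ξ | ∀ γ : UnitRay X, Quotient.mk (unitRaySetoid X) γ = ξ →
    ∃ T : ℝ≥0, ∀ t : ℝ≥0, T ≤ t → γ.1 t ∈ C}

/-- The connected components of the complement of a point. -/
def treeComps {X : Type*} [TopologicalSpace X] (x : X) : Set (Set X) :=
  {C | ∃ y : X, y ≠ x ∧ C = connectedComponentIn {x}ᶜ y}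

/-- A vertex (branch point) of a tree: the complement has at least three components. -/
def IsTreeVertex {X : Type*} [TopologicalSpace X] (x : X) : Prop :=
  ∃ C₁ C₂ C₃ : Set X, C₁ ∈ treeComps x ∧ C₂ ∈ treeComps x ∧ C₃ ∈ treeComps x ∧
    C₁ ≠ C₂ ∧ C₂ ≠ C₃ ∧ C₁ ≠ C₃

/-- The value of the signed measure `ν₊ - ν₋` on a set of boundary points. -/
def sflow {X : Type*} [MetricSpace X] (νm νp : Measure (Boundary X))
    (S : Set (Boundary X)) : ℝ :=
  (νp S).toReal - (νm S).toReal

/-- The boundary directions at `x` carrying positive flow. -/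
def posBdrySet {X : Type*} [MetricSpace X] (νm νp : Measure (Boundary X)) (x : X) :
    Set (Boundary X) :=
  ⋃ (C : Set X) (_ : C ∈ treeComps x) (_ : 0 < sflow νm νp (compBdry C)), compBdry C

/-- The boundary directions at `x` carrying negative flow. -/
def negBdrySet {X : Type*} [MetricSpace X] (νm νp : Measure (Boundary X)) (x : X) :
    Set (Boundary X) :=
  ⋃ (C : Set X) (_ : C ∈ treeComps x) (_ : sflow νm νp (compBdry C) < 0), compBdry C

/-- The flow through the point `x`. -/
def flowAt {X : Type*} [MetricSpace X] (νm νp : Measure (Boundary X)) (x : X) : ℝ :=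
  sflow νm νp (posBdrySet νm νp x)

open Classical in
/-- The specific flow through `x`: the flow through `x`, not counting the edge pointing
towards the base point `x₀` when the latter is positive (resp. negative). -/
def specificFlow {X : Type*} [MetricSpace X] (νm νp : Measure (Boundary X))
    (x₀ x : X) : ℝ :=
  if x = x₀ then flowAt νm νp x
  else if 0 < sflow νm νp (compBdry (connectedComponentIn {x}ᶜ x₀)) then
    sflow νm νp (posBdrySet νm νp x \ compBdry (connectedComponentIn {x}ᶜ x₀))
  else if sflow νm νp (compBdry (connectedComponentIn {x}ᶜ x₀)) < 0 then
    - sflow νm νp (negBdrySet νm νp x \ compBdry (connectedComponentIn {x}ᶜ x₀))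
  else flowAt νm νp x

/-- The pair `(ν₋, ν₊)` is realized as the pair of ends of a complete unit-speed geodesic of
the Wasserstein space, through a displacement interpolation `m`. -/
def RealizableEnds {X : Type*} [MetricSpace X] [MeasurableSpace X]
    (νm νp : Measure (Boundary X)) : Prop :=
  ∃ (μt : ℝ → W2Space X) (m : Measure (GeoLine X)), IsProbabilityMeasure m ∧
    (∀ s t : ℝ, Wdist (μt s) (μt t) = |s - t|) ∧
    (∀ t : ℝ, m.map (fun γ : GeoLine X => γ.1 t) = (μt t).1) ∧
    m.map lineEndMinus = νm.map (fun ξ : Boundary X => coneMk ξ 1) ∧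
    m.map lineEndPlus = νp.map (fun ξ : Boundary X => coneMk ξ 1)

/-- The cost `∫ D₀² dπ` of a transport plan (the optimal transport problem for the cost
`-D₀²` is finite iff the supremum of this quantity over all couplings is finite, and its
minimizers are the maximizers of this quantity). -/
def D0cost {X : Type*} [MetricSpace X] (x₀ : X)
    (π : Measure (Boundary X × Boundary X)) : ℝ≥0∞ :=
  ∫⁻ p, ENNReal.ofReal (D0 x₀ p.1 p.2) ^ 2 ∂π

/-- The supremum of `∫ D₀² dπ` over couplings of `(ν₋, ν₊)`. -/
def D0supCost {X : Type*} [MetricSpace X] (x₀ : X) (νm νp : Measure (Boundary X)) : ℝ≥0∞ :=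
  ⨆ (π : Measure (Boundary X × Boundary X)) (_ : IsCoupling π νm νp), D0cost x₀ π

/-! ## The geodesic boundary of the Wasserstein space -/

/-- The metric topology of the Wasserstein distance. -/
instance (Y : Type*) [MetricSpace Y] [MeasurableSpace Y] : TopologicalSpace (W2Space Y) :=
  TopologicalSpace.generateFrom
    {S | ∃ (μ : W2Space Y) (ε : ℝ), S = {ν : W2Space Y | Wdist μ ν < ε}}

/-- Unit-speed geodesic rays of the Wasserstein space. -/
abbrev W2UnitRay (X : Type*) [MetricSpace X] [MeasurableSpace X] : Type _ :=
  {f : ℝ≥0 → W2Space X // ∀ s t : ℝ≥0, Wdist (f s) (f t) = dist s t}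

/-- Probability measures on the cone over the boundary with `∫ v² dν = 1`, with the weak
topology. -/
abbrev P1Cone (X : Type*) [MetricSpace X] : Type _ :=
  {ν : ProbabilityMeasure (Cone (Boundary X)) //
    ∫⁻ c, (coneSpeed c : ℝ≥0∞) ^ 2 ∂(ν : Measure (Cone (Boundary X))) = 1}

/-- Probability measures (as plain measures) on the cone over the boundary with
`∫ v² dν = 1`. -/
abbrev P1ConeM (X : Type*) [MetricSpace X] : Type _ :=
  {ν : Measure (Cone (Boundary X)) // IsProbabilityMeasure ν ∧
    ∫⁻ c, (coneSpeed c : ℝ≥0∞) ^ 2 ∂ν = 1}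


/-! ## Locally Riemannian points -/

/-- The Riemannian length of a path `γ : [0,1] → ℝⁿ` for the metric tensor `g`. -/
def riemannianPathLength {n : ℕ}
    (g : EuclideanSpace ℝ (Fin n) → EuclideanSpace ℝ (Fin n) →L[ℝ] EuclideanSpace ℝ (Fin n))
    (γ : ℝ → EuclideanSpace ℝ (Fin n)) : ℝ :=
  ∫ t in (0:ℝ)..1, Real.sqrt (@inner ℝ _ _ (g (γ t) (deriv γ t)) (deriv γ t))

/-- The Riemannian distance in `U ⊆ ℝⁿ` for the metric tensor `g`: the infimum of
Riemannian lengths of `C¹` paths in `U` joining the two points. -/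
def riemannianDist {n : ℕ} (U : Set (EuclideanSpace ℝ (Fin n)))
    (g : EuclideanSpace ℝ (Fin n) → EuclideanSpace ℝ (Fin n) →L[ℝ] EuclideanSpace ℝ (Fin n))
    (p q : EuclideanSpace ℝ (Fin n)) : ℝ :=
  sInf {L : ℝ | ∃ γ : ℝ → EuclideanSpace ℝ (Fin n), ContDiffOn ℝ 1 γ (Set.Icc (0:ℝ) 1) ∧
    (∀ t ∈ Set.Icc (0:ℝ) 1, γ t ∈ U) ∧ γ 0 = p ∧ γ 1 = q ∧ L = riemannianPathLength g γ}

/-- `x` admits a neighborhood isometric to an open subset of a Riemannian manifold of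
dimension at least 2 (expressed in a chart: an open subset of `ℝⁿ`, `n ≥ 2`, equipped with
the distance induced by a smooth positive-definite symmetric metric tensor). -/
def IsLocallyRiemannian (X : Type*) [MetricSpace X] (x : X) : Prop :=
  ∃ n : ℕ, 2 ≤ n ∧
  ∃ (U : Set (EuclideanSpace ℝ (Fin n)))
    (g : EuclideanSpace ℝ (Fin n) → EuclideanSpace ℝ (Fin n) →L[ℝ] EuclideanSpace ℝ (Fin n))
    (V : Set X) (φ : X → EuclideanSpace ℝ (Fin n)),
    IsOpen U ∧ ContDiffOn ℝ (⊤ : ℕ∞) g U ∧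
    (∀ p ∈ U, ∀ v w : EuclideanSpace ℝ (Fin n),
      @inner ℝ _ _ (g p v) w = @inner ℝ _ _ v (g p w)) ∧
    (∀ p ∈ U, ∀ v : EuclideanSpace ℝ (Fin n), v ≠ 0 → 0 < @inner ℝ _ _ (g p v) v) ∧
    V ∈ nhds x ∧ Set.BijOn φ V U ∧
    ∀ a ∈ V, ∀ b ∈ V, dist a b = riemannianDist U g (φ a) (φ b)

/-! ## The combinatorial perpendicular Radon transform on a tree -/

/-- `y` and `z` lie in the same connected component of the graph `G` minus the vertex `x`. -/
def sameComp {V : Type*} (G : SimpleGraph V) (x y z : V) : Prop :=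
  ∃ (hy : y ≠ x) (hz : z ≠ x), (G.induce {w : V | w ≠ x}).Reachable ⟨y, hy⟩ ⟨z, hz⟩

/-- The perpendicular `⊥ˣ(ef)` of a flag: the union of `{x}` and of the components of
`G - x` containing none of the vertices of `p` (for a flag, `p = {e, f}` is a pair of
neighbors of `x`). -/
def perpSet {V : Type*} (G : SimpleGraph V) (x : V) (p : Finset V) : Set V :=
  {x} ∪ {y | ∀ e ∈ p, ¬ sameComp G x y e}

/-- The combinatorial perpendicular Radon transform of a summable function `h` on the
vertices, evaluated on a flag `(x, p)`. -/
def perpRadon {V : Type*} (G : SimpleGraph V) (h : V → ℝ) (x : V) (p : Finset V) : ℝ :=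
  ∑' y : perpSet G x p, h y


section Couplings

variable {A : Type*} [MeasurableSpace A]

lemma isCoupling_prod (μ ν : Measure A) [IsProbabilityMeasure μ] [IsProbabilityMeasure ν] :
    IsCoupling (μ.prod ν) μ ν :=
  ⟨by simp, by simp⟩

lemma IsCoupling.swap {μ ν : Measure A} {π : Measure (A × A)} (hπ : IsCoupling π μ ν) :
    IsCoupling (π.map Prod.swap) ν μ := by
  refine ⟨?_, ?_⟩
  · rw [Measure.map_map measurable_fst measurable_swap, ← hπ.2]; rfl
  · rw [Measure.map_map measurable_snd measurable_swap, ← hπ.1]; rfl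

lemma IsCoupling.lintegral_fst {μ ν : Measure A} {π : Measure (A × A)}
    (hπ : IsCoupling π μ ν) {f : A → ℝ≥0∞} (hf : Measurable f) :
    ∫⁻ p, f p.1 ∂π = ∫⁻ x, f x ∂μ := by
  rw [← hπ.1, lintegral_map hf measurable_fst]

lemma IsCoupling.lintegral_snd {μ ν : Measure A} {π : Measure (A × A)}
    (hπ : IsCoupling π μ ν) {f : A → ℝ≥0∞} (hf : Measurable f) :
    ∫⁻ p, f p.2 ∂π = ∫⁻ x, f x ∂ν := by
  rw [← hπ.2, lintegral_map hf measurable_snd]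

end Couplings

lemma edist_sq_le_two_mul {A : Type*} [MetricSpace A] (x y z : A) :
    edist x z ^ 2 ≤ 2 * edist x y ^ 2 + 2 * edist y z ^ 2 := by
  rw [← ENNReal.toReal_le_toReal (by finiteness) (by finiteness),
    ENNReal.toReal_add (by finiteness) (by finiteness)]
  simp only [ENNReal.toReal_pow, ENNReal.toReal_mul, ENNReal.toReal_ofNat, ← dist_edist]
  nlinarith [dist_triangle x y z, sq_nonneg (dist x y - dist y z), dist_nonneg (x := x) (y := z)]

section TransportCost

variable {A : Type*} [MetricSpace A] [MeasurableSpace A]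

lemma W2cost_eq_iInf_edist (μ ν : Measure A) :
    W2cost μ ν = ⨅ (π : Measure (A × A)) (_ : IsCoupling π μ ν),
      ∫⁻ p, edist p.1 p.2 ^ 2 ∂π := by
  simp only [W2cost, edist_dist]

lemma W2cost_le {μ ν : Measure A} {π : Measure (A × A)} (hπ : IsCoupling π μ ν) :
    W2cost μ ν ≤ ∫⁻ p, edist p.1 p.2 ^ 2 ∂π := by
  rw [W2cost_eq_iInf_edist]
  exact iInf₂_le π hπ

lemma le_W2cost {μ ν : Measure A} {c : ℝ≥0∞}
    (h : ∀ π : Measure (A × A), IsCoupling π μ ν → c ≤ ∫⁻ p, edist p.1 p.2 ^ 2 ∂π) :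
    c ≤ W2cost μ ν := by
  rw [W2cost_eq_iInf_edist]
  exact le_iInf₂ h

/-- The transport cost of the independent coupling. -/
def indepCost (μ ν : Measure A) : ℝ≥0∞ := ∫⁻ x, ∫⁻ y, edist x y ^ 2 ∂ν ∂μ

variable [BorelSpace A]

lemma measurable_edist_sq_left (x : A) : Measurable fun y : A => edist x y ^ 2 := by fun_prop

lemma lintegral_edist_sq_lt_top (μ : W2Space A) (x : A) : ∫⁻ y, edist x y ^ 2 ∂μ.1 < ⊤ := by
  obtain ⟨hp, x₀, h⟩ := μ.2
  simp only [← edist_dist] at h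
  calc ∫⁻ y, edist x y ^ 2 ∂μ.1
      ≤ ∫⁻ y, (2 * edist x x₀ ^ 2 + 2 * edist x₀ y ^ 2) ∂μ.1 :=
        lintegral_mono fun y => edist_sq_le_two_mul x x₀ y
    _ = 2 * edist x x₀ ^ 2 + 2 * ∫⁻ y, edist x₀ y ^ 2 ∂μ.1 := by
        rw [lintegral_add_left measurable_const, lintegral_const_mul _ (measurable_edist_sq_left x₀)]
        simp
    _ < ⊤ := by finiteness

lemma indepCost_lt_top (μ ν : W2Space A) : indepCost μ.1 ν.1 < ⊤ := by
  have := μ.2.1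
  have := ν.2.1
  obtain ⟨x₀, -⟩ := μ.2.2
  have h1 := lintegral_edist_sq_lt_top μ x₀
  have h2 := lintegral_edist_sq_lt_top ν x₀
  calc indepCost μ.1 ν.1
      ≤ ∫⁻ x, ∫⁻ y, (2 * edist x₀ x ^ 2 + 2 * edist x₀ y ^ 2) ∂ν.1 ∂μ.1 := by
        refine lintegral_mono fun x => lintegral_mono fun y => ?_
        simpa [edist_comm x x₀] using edist_sq_le_two_mul x x₀ y
    _ = 2 * ∫⁻ x, edist x₀ x ^ 2 ∂μ.1 + 2 * ∫⁻ y, edist x₀ y ^ 2 ∂ν.1 := by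
        simp_rw [lintegral_add_left measurable_const,
          lintegral_const_mul _ (measurable_edist_sq_left x₀)]
        rw [lintegral_add_right _ measurable_const]
        simp [lintegral_const_mul _ (measurable_edist_sq_left x₀)]
    _ < ⊤ := by finiteness

variable [SecondCountableTopology A]

lemma measurable_edist_sq : Measurable fun p : A × A => edist p.1 p.2 ^ 2 := by fun_prop

lemma lintegral_prod_eq_indepCost (μ ν : Measure A) [IsProbabilityMeasure ν] :
    ∫⁻ p, edist p.1 p.2 ^ 2 ∂(μ.prod ν) = indepCost μ ν :=
  lintegral_prod _ measurable_edist_sq.aemeasurable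

lemma W2cost_le_indepCost (μ ν : Measure A) [IsProbabilityMeasure μ]
    [IsProbabilityMeasure ν] : W2cost μ ν ≤ indepCost μ ν :=
  (W2cost_le (isCoupling_prod μ ν)).trans_eq (lintegral_prod_eq_indepCost μ ν)

lemma W2cost_comm (μ ν : Measure A) : W2cost μ ν = W2cost ν μ := by
  have key : ∀ μ ν : Measure A, W2cost μ ν ≤ W2cost ν μ := fun μ ν => by
    refine le_W2cost fun π hπ => (W2cost_le hπ.swap).trans_eq ?_
    rw [lintegral_map measurable_edist_sq measurable_swap]
    exact lintegral_congr fun p => by simp [edist_comm]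
  exact le_antisymm (key μ ν) (key ν μ)

lemma indepCost_comm (μ ν : Measure A) [IsProbabilityMeasure μ] [IsProbabilityMeasure ν] :
    indepCost μ ν = indepCost ν μ := by
  rw [indepCost, lintegral_lintegral_swap measurable_edist_sq.aemeasurable]
  simp only [indepCost, edist_comm]

lemma indepCost_dirac_left (x : A) (ν : Measure A) [IsProbabilityMeasure ν] :
    indepCost (Measure.dirac x) ν = ∫⁻ y, edist x y ^ 2 ∂ν := by
  rw [indepCost, lintegral_dirac']
  exact measurable_edist_sq.lintegral_prod_right'

lemma W2cost_dirac_left (x : A) (ν : Measure A) [IsProbabilityMeasure ν] :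
    W2cost (Measure.dirac x) ν = ∫⁻ y, edist x y ^ 2 ∂ν := by
  refine le_antisymm ((W2cost_le_indepCost _ _).trans_eq (indepCost_dirac_left x ν)) ?_
  refine le_W2cost fun π hπ => ?_
  have hx : ∀ᵐ p ∂π, p.1 = x := by
    have h : ∀ᵐ y ∂(π.map Prod.fst), y = x := by
      rw [hπ.1]
      exact (ae_dirac_iff (p := fun y => y = x) (measurableSet_singleton x)).2 rfl
    exact ae_of_ae_map measurable_fst.aemeasurable h
  rw [← hπ.lintegral_snd (measurable_edist_sq_left x)]
  refine (lintegral_congr_ae ?_).le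
  filter_upwards [hx] with p hp
  rw [hp]

lemma W2cost_dirac_right (ν : Measure A) (x : A) [IsProbabilityMeasure ν] :
    W2cost ν (Measure.dirac x) = ∫⁻ y, edist x y ^ 2 ∂ν := by
  rw [W2cost_comm, W2cost_dirac_left]

lemma W2cost_dirac_dirac (x y : A) :
    W2cost (Measure.dirac x) (Measure.dirac y) = edist x y ^ 2 := by
  rw [W2cost_dirac_left, lintegral_dirac' _ (measurable_edist_sq_left x)]

lemma W2cost_lt_top (μ ν : W2Space A) : W2cost μ.1 ν.1 < ⊤ := by
  have := μ.2.1
  have := ν.2.1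
  exact (W2cost_le_indepCost _ _).trans_lt (indepCost_lt_top μ ν)

lemma Wdist_eq_Wdist_iff {B : Type*} [MetricSpace B] [MeasurableSpace B] [BorelSpace B]
    [SecondCountableTopology B] (μ ν : W2Space A) (μ' ν' : W2Space B) :
    Wdist μ ν = Wdist μ' ν' ↔ W2cost μ.1 ν.1 = W2cost μ'.1 ν'.1 := by
  rw [Wdist, Wdist, Real.sqrt_inj ENNReal.toReal_nonneg ENNReal.toReal_nonneg,
    ENNReal.toReal_eq_toReal_iff' (W2cost_lt_top μ ν).ne (W2cost_lt_top μ' ν').ne]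

/-- The Dirac mass as a point of the Wasserstein space. -/
def diracW2 (x : A) : W2Space A :=
  ⟨Measure.dirac x, inferInstance, x, by
    simp only [← edist_dist]
    rw [lintegral_dirac' _ (measurable_edist_sq_left x)]
    simp⟩

end TransportCost

lemma mul_dist_sq_add_le_of_dist_ge {A : Type*} [MetricSpace A] {p q x y : A}
    {t δ : ℝ} (ht0 : 0 ≤ t) (ht1 : t ≤ 1) (hδ : 0 < δ)
    (hx : δ ≤ |dist p x - t * dist p q|) (hy : dist y q < δ / 2) :
    δ ^ 2 / 4 + t * (1 - t) * dist p y ^ 2 ≤ t * dist x y ^ 2 + (1 - t) * dist p x ^ 2 := by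
  have hxy : (dist p x - dist p y) ^ 2 ≤ dist x y ^ 2 := by
    rw [← sq_abs]
    gcongr
    simpa [dist_comm] using abs_dist_sub_le x y p
  have hyq : |t * dist p y - t * dist p q| ≤ δ / 2 := by
    rw [← mul_sub, abs_mul, abs_of_nonneg ht0]
    have h : |dist p y - dist p q| ≤ dist y q := by
      simpa [dist_comm] using abs_dist_sub_le y q p
    nlinarith [abs_nonneg (dist p y - dist p q)]
  have hlow : δ / 2 ≤ |dist p x - t * dist p y| := by
    have := abs_sub_le (dist p x) (t * dist p y) (t * dist p q)
    linarith
  have hsq : (δ / 2) ^ 2 ≤ (dist p x - t * dist p y) ^ 2 := by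
    rw [← sq_abs (dist p x - t * dist p y)]
    gcongr
  nlinarith [mul_le_mul_of_nonneg_left hxy ht0]

lemma mul_dist_sq_le {A : Type*} [MetricSpace A] {p x y : A} {t : ℝ} (ht0 : 0 ≤ t) :
    t * (1 - t) * dist p y ^ 2 ≤ t * dist x y ^ 2 + (1 - t) * dist p x ^ 2 := by
  have hxy : (dist p x - dist p y) ^ 2 ≤ dist x y ^ 2 := by
    rw [← sq_abs]
    gcongr
    simpa [dist_comm] using abs_dist_sub_le x y p
  nlinarith [mul_le_mul_of_nonneg_left hxy ht0, sq_nonneg (dist p x - t * dist p y)]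

section Perturbation

lemma W2cost_lt_of_exchange {A : Type*} [MetricSpace A] [MeasurableSpace A]
    {μ ν : Measure A} {P M N : Measure (A × A)}
    [IsFiniteMeasure P] (hP : IsCoupling P μ ν) (hMP : M ≤ P)
    (hfst : N.map Prod.fst = M.map Prod.fst) (hsnd : N.map Prod.snd = M.map Prod.snd)
    (hfin : ∫⁻ p, edist p.1 p.2 ^ 2 ∂P ≠ ⊤)
    (hlt : ∫⁻ p, edist p.1 p.2 ^ 2 ∂N < ∫⁻ p, edist p.1 p.2 ^ 2 ∂M) :
    W2cost μ ν < ∫⁻ p, edist p.1 p.2 ^ 2 ∂P := by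
  have : IsFiniteMeasure M := isFiniteMeasure_of_le P hMP
  have hPM : P - M + M = P := Measure.sub_add_cancel_of_le hMP
  have hcoup : IsCoupling (P - M + N) μ ν := by
    constructor
    · rw [Measure.map_add _ _ measurable_fst, hfst, ← Measure.map_add _ _ measurable_fst, hPM, hP.1]
    · rw [Measure.map_add _ _ measurable_snd, hsnd, ← Measure.map_add _ _ measurable_snd, hPM, hP.2]
  have hcost : ∫⁻ p, edist p.1 p.2 ^ 2 ∂P
      = ∫⁻ p, edist p.1 p.2 ^ 2 ∂(P - M) + ∫⁻ p, edist p.1 p.2 ^ 2 ∂M := by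
    rw [← lintegral_add_measure, hPM]
  have hfin' : ∫⁻ p, edist p.1 p.2 ^ 2 ∂(P - M) ≠ ⊤ :=
    ne_top_of_le_ne_top hfin (hcost ▸ le_self_add)
  refine (W2cost_le hcoup).trans_lt ?_
  rw [lintegral_add_measure, hcost]
  exact (ENNReal.add_lt_add_iff_left hfin').2 hlt

variable {A : Type*} [MetricSpace A] [MeasurableSpace A] [BorelSpace A]
  [SecondCountableTopology A]

lemma measure_annulus_pos_of_interpolation {p q : A} {t δ : ℝ} (ht0 : 0 < t) (ht1 : t ≤ 1)
    {ν lam : Measure A} [IsProbabilityMeasure ν] [IsProbabilityMeasure lam]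
    (hfin : ∫⁻ y, edist p y ^ 2 ∂lam < ⊤)
    (hν : ∫⁻ x, edist p x ^ 2 ∂ν = ENNReal.ofReal t ^ 2 * ∫⁻ y, edist p y ^ 2 ∂lam)
    (hC : W2cost ν lam = ENNReal.ofReal (1 - t) ^ 2 * ∫⁻ y, edist p y ^ 2 ∂lam)
    (hq : ∀ ε > 0, 0 < lam (Metric.ball q ε)) (hδ : 0 < δ) :
    0 < ν {x | |dist p x - t * dist p q| < δ} := by
  by_contra hS
  have hS0 : ν {x | |dist p x - t * dist p q| < δ} = 0 := by simpa using hS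
  have hae : ∀ᵐ x ∂ν, δ ≤ |dist p x - t * dist p q| := by
    rw [ae_iff]
    simpa using hS0
  set D := ∫⁻ y, edist p y ^ 2 ∂lam with hD
  set B := Metric.ball q (δ / 2) with hB
  have hBm : MeasurableSet B := Metric.isOpen_ball.measurableSet
  have hpt : ∀ x y : A, δ ≤ |dist p x - t * dist p q| →
      B.indicator (fun _ => ENNReal.ofReal (δ ^ 2 / 4)) y
        + ENNReal.ofReal (t * (1 - t)) * edist p y ^ 2
      ≤ ENNReal.ofReal t * edist x y ^ 2 + ENNReal.ofReal (1 - t) * edist p x ^ 2 := by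
    intro x y hx
    have h1t : 0 ≤ 1 - t := by linarith
    simp only [edist_dist, ← ENNReal.ofReal_pow dist_nonneg]
    rw [← ENNReal.ofReal_mul (by positivity), ← ENNReal.ofReal_mul (by positivity),
      ← ENNReal.ofReal_mul (by positivity), ← ENNReal.ofReal_add (by positivity) (by positivity)]
    by_cases hy : y ∈ B
    · rw [indicator_of_mem hy, ← ENNReal.ofReal_add (by positivity) (by positivity)]
      exact ENNReal.ofReal_le_ofReal (mul_dist_sq_add_le_of_dist_ge ht0.le ht1 hδ hx hy)
    · rw [indicator_of_notMem hy, zero_add]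
      exact ENNReal.ofReal_le_ofReal (mul_dist_sq_le ht0.le)
  have hle : (ENNReal.ofReal (δ ^ 2 / 4) * lam B + ENNReal.ofReal (t * (1 - t)) * D
      - ENNReal.ofReal (1 - t) * (ENNReal.ofReal t ^ 2 * D)) / ENNReal.ofReal t
      ≤ W2cost ν lam := by
    refine le_W2cost fun π hπ => ?_
    refine ENNReal.div_le_of_le_mul (tsub_le_iff_right.2 ?_)
    have hπae : ∀ᵐ z ∂π, δ ≤ |dist p z.1 - t * dist p q| := by
      rw [← hπ.1] at hae
      exact ae_of_ae_map measurable_fst.aemeasurable hae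
    have hm1 : Measurable (B.indicator (fun _ : A => ENNReal.ofReal (δ ^ 2 / 4))) :=
      measurable_const.indicator hBm
    have hm2 := measurable_edist_sq_left p
    calc ENNReal.ofReal (δ ^ 2 / 4) * lam B + ENNReal.ofReal (t * (1 - t)) * D
        = ∫⁻ z, (B.indicator (fun _ => ENNReal.ofReal (δ ^ 2 / 4)) z.2
            + ENNReal.ofReal (t * (1 - t)) * edist p z.2 ^ 2) ∂π := by
          rw [hπ.lintegral_snd (f := fun y => B.indicator (fun _ => ENNReal.ofReal (δ ^ 2 / 4)) y
            + ENNReal.ofReal (t * (1 - t)) * edist p y ^ 2) (hm1.add (hm2.const_mul _)),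
            lintegral_add_left hm1, lintegral_const_mul _ hm2, lintegral_indicator_const hBm]
      _ ≤ ∫⁻ z, (ENNReal.ofReal t * edist z.1 z.2 ^ 2
            + ENNReal.ofReal (1 - t) * edist p z.1 ^ 2) ∂π := by
          refine lintegral_mono_ae ?_
          filter_upwards [hπae] with z hz using hpt z.1 z.2 hz
      _ = (∫⁻ z, edist z.1 z.2 ^ 2 ∂π) * ENNReal.ofReal t
            + ENNReal.ofReal (1 - t) * (ENNReal.ofReal t ^ 2 * D) := by
          rw [lintegral_add_left (measurable_edist_sq.const_mul _),
            lintegral_const_mul _ measurable_edist_sq,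
            hπ.lintegral_fst (f := fun x => ENNReal.ofReal (1 - t) * edist p x ^ 2)
              (hm2.const_mul _), lintegral_const_mul _ hm2, hν, mul_comm (ENNReal.ofReal t)]
  have hle' : ENNReal.ofReal (δ ^ 2 / 4) * lam B + ENNReal.ofReal (t * (1 - t)) * D
      ≤ ENNReal.ofReal (t * (1 - t)) * D := by
    rw [ENNReal.div_le_iff (by simpa using ht0) ENNReal.ofReal_ne_top, tsub_le_iff_right,
      hC] at hle
    refine hle.trans_eq ?_
    have h1t : 0 ≤ 1 - t := by linarith
    have : ENNReal.ofReal (t * (1 - t)) = ENNReal.ofReal (1 - t) ^ 2 * ENNReal.ofReal t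
        + ENNReal.ofReal (1 - t) * ENNReal.ofReal t ^ 2 := by
      rw [← ENNReal.ofReal_pow h1t, ← ENNReal.ofReal_pow ht0.le,
        ← ENNReal.ofReal_mul (by positivity), ← ENNReal.ofReal_mul (by positivity),
        ← ENNReal.ofReal_add (by positivity) (by positivity)]
      congr 1
      ring
    rw [this]
    ring
  have h0 : ENNReal.ofReal (δ ^ 2 / 4) * lam B = 0 := by
    have hfin' : ENNReal.ofReal (t * (1 - t)) * D ≠ ⊤ := by finiteness
    simpa using (ENNReal.add_le_add_iff_right hfin').1 (hle'.trans_eq (zero_add _).symm)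
  have hpos : ENNReal.ofReal (δ ^ 2 / 4) * lam B ≠ 0 :=
    mul_ne_zero (by simpa using by positivity) (hq _ (by positivity)).ne'
  exact hpos h0

/-- The independent coupling is not optimal as soon as both measures charge two balls that are
far apart from each other. -/
lemma W2cost_lt_indepCost {ν ν' : Measure A} [IsProbabilityMeasure ν] [IsProbabilityMeasure ν']
    (hfin : indepCost ν ν' ≠ ⊤) {v w : A} {δ : ℝ} (hδ : 0 < δ) (hvw : 5 * δ ≤ dist v w)
    (hv : 0 < ν (Metric.ball v δ)) (hw : 0 < ν (Metric.ball w δ))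
    (hv' : 0 < ν' (Metric.ball v δ)) (hw' : 0 < ν' (Metric.ball w δ)) :
    W2cost ν ν' < indepCost ν ν' := by
  set V := Metric.ball v δ with hV
  set W := Metric.ball w δ with hW
  have hVm : MeasurableSet V := Metric.isOpen_ball.measurableSet
  have hWm : MeasurableSet W := Metric.isOpen_ball.measurableSet
  have hcost : ∀ S T : Set A, ∫⁻ p, edist p.1 p.2 ^ 2 ∂((ν.restrict S).prod (ν'.restrict T))
      = ∫⁻ p in S ×ˢ T, edist p.1 p.2 ^ 2 ∂(ν.prod ν') := fun S T => by
    rw [Measure.prod_restrict]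
  have hlow : ∀ S T : Set A, MeasurableSet S → MeasurableSet T →
      (∀ x ∈ S, ∀ y ∈ T, 3 * δ ≤ dist x y) →
      ENNReal.ofReal (3 * δ) ^ 2 * (ν S * ν' T)
        ≤ ∫⁻ p, edist p.1 p.2 ^ 2 ∂((ν.restrict S).prod (ν'.restrict T)) := by
    intro S T hS hT h
    rw [hcost, ← Measure.prod_prod, ← setLIntegral_const]
    refine setLIntegral_mono measurable_edist_sq fun p hp => ?_
    rw [edist_dist]
    gcongr
    exact h _ hp.1 _ hp.2
  have hup : ∀ S T : Set A, MeasurableSet S → MeasurableSet T →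
      (∀ x ∈ S, ∀ y ∈ T, dist x y ≤ 2 * δ) →
      ∫⁻ p, edist p.1 p.2 ^ 2 ∂((ν.restrict S).prod (ν'.restrict T))
        ≤ ENNReal.ofReal (2 * δ) ^ 2 * (ν S * ν' T) := by
    intro S T hS hT h
    rw [hcost, ← Measure.prod_prod, ← setLIntegral_const]
    refine setLIntegral_mono measurable_const fun p hp => ?_
    rw [edist_dist]
    gcongr
    exact h _ hp.1 _ hp.2
  have hVW : ∀ x ∈ V, ∀ y ∈ W, 3 * δ ≤ dist x y := fun x hx y hy => by
    have h1 : dist x v < δ := hx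
    have h2 : dist y w < δ := hy
    have := dist_triangle4 v x y w
    rw [dist_comm v x] at this
    linarith
  have hball : ∀ u : A, ∀ x ∈ Metric.ball u δ, ∀ y ∈ Metric.ball u δ, dist x y ≤ 2 * δ :=
    fun u x hx y hy => by
      have h1 : dist x u < δ := hx
      have h2 : dist y u < δ := hy
      linarith [dist_triangle_right x y u]
  set M : Measure (A × A) := (2⁻¹ : ℝ≥0∞) •
    ((ν W * ν' V) • (ν.restrict V).prod (ν'.restrict W)
      + (ν V * ν' W) • (ν.restrict W).prod (ν'.restrict V)) with hM
  set N : Measure (A × A) := (2⁻¹ : ℝ≥0∞) •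
    ((ν W * ν' W) • (ν.restrict V).prod (ν'.restrict V)
      + (ν V * ν' V) • (ν.restrict W).prod (ν'.restrict W)) with hN
  rw [← lintegral_prod_eq_indepCost] at hfin ⊢
  refine W2cost_lt_of_exchange (isCoupling_prod ν ν') (M := M) (N := N) ?_ ?_ ?_ hfin ?_
  · have hle : ∀ (a b : ℝ≥0∞) (S T : Set A), a ≤ 1 → b ≤ 1 →
        (a * b) • (ν.restrict S).prod (ν'.restrict T) ≤ ν.prod ν' := by
      intro a b S T ha hb
      refine Measure.le_iff.2 fun s _ => ?_
      rw [Measure.smul_apply, smul_eq_mul, Measure.prod_restrict]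
      calc a * b * (ν.prod ν').restrict (S ×ˢ T) s
          ≤ 1 * 1 * (ν.prod ν') s := by gcongr; exact Measure.restrict_le_self
        _ = (ν.prod ν') s := by simp
    refine Measure.le_iff.2 fun s _ => ?_
    rw [hM, Measure.smul_apply, Measure.add_apply, smul_eq_mul]
    calc _ ≤ (2⁻¹ : ℝ≥0∞) * ((ν.prod ν') s + (ν.prod ν') s) := by
          gcongr
          · exact hle _ _ V W prob_le_one prob_le_one
          · exact hle _ _ W V prob_le_one prob_le_one
      _ = (ν.prod ν') s := by
          rw [← two_mul, ← mul_assoc, ENNReal.inv_mul_cancel two_ne_zero ENNReal.ofNat_ne_top,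
            one_mul]
  · simp only [hM, hN, Measure.map_smul, Measure.map_add _ _ measurable_fst, Measure.map_fst_prod,
      smul_smul, Measure.restrict_apply_univ]
    ring_nf
  · simp only [hM, hN, Measure.map_smul, Measure.map_add _ _ measurable_snd, Measure.map_snd_prod,
      smul_smul, Measure.restrict_apply_univ]
    rw [add_comm]
    ring_nf
  · set K := ν V * ν W * (ν' V * ν' W) with hK
    have hK0 : K ≠ 0 := by
      simp [hK, hv.ne', hw.ne', hv'.ne', hw'.ne']
    have hKtop : K ≠ ⊤ := by finiteness
    have h2 : (2⁻¹ : ℝ≥0∞) * 2 = 1 := ENNReal.inv_mul_cancel two_ne_zero ENNReal.ofNat_ne_top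
    have hMlow : ENNReal.ofReal (3 * δ) ^ 2 * K ≤ ∫⁻ p, edist p.1 p.2 ^ 2 ∂M := by
      rw [hM, lintegral_smul_measure, lintegral_add_measure, lintegral_smul_measure,
        lintegral_smul_measure]
      simp only [smul_eq_mul]
      have e1 := hlow V W hVm hWm hVW
      have e2 := hlow W V hWm hVm fun x hx y hy => dist_comm x y ▸ hVW y hy x hx
      calc ENNReal.ofReal (3 * δ) ^ 2 * K
          = 2⁻¹ * 2 * (ENNReal.ofReal (3 * δ) ^ 2 * K) := by rw [h2, one_mul]
        _ = 2⁻¹ * (ν W * ν' V * (ENNReal.ofReal (3 * δ) ^ 2 * (ν V * ν' W))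
            + ν V * ν' W * (ENNReal.ofReal (3 * δ) ^ 2 * (ν W * ν' V))) := by rw [hK]; ring
        _ ≤ _ := by gcongr
    have hNup : ∫⁻ p, edist p.1 p.2 ^ 2 ∂N ≤ ENNReal.ofReal (2 * δ) ^ 2 * K := by
      rw [hN, lintegral_smul_measure, lintegral_add_measure, lintegral_smul_measure,
        lintegral_smul_measure]
      simp only [smul_eq_mul]
      have e1 := hup V V hVm hVm (hball v)
      have e2 := hup W W hWm hWm (hball w)
      calc _ ≤ 2⁻¹ * (ν W * ν' W * (ENNReal.ofReal (2 * δ) ^ 2 * (ν V * ν' V))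
            + ν V * ν' V * (ENNReal.ofReal (2 * δ) ^ 2 * (ν W * ν' W))) := by gcongr
        _ = 2⁻¹ * 2 * (ENNReal.ofReal (2 * δ) ^ 2 * K) := by rw [hK]; ring
        _ = _ := by rw [h2, one_mul]
    refine hNup.trans_lt (lt_of_lt_of_le ?_ hMlow)
    refine ENNReal.mul_lt_mul_left hK0 hKtop ?_
    have h23 : ENNReal.ofReal (2 * δ) < ENNReal.ofReal (3 * δ) :=
      (ENNReal.ofReal_lt_ofReal_iff (by positivity)).2 (by linarith)
    exact ENNReal.pow_lt_pow_left two_ne_zero h23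

end Perturbation

lemma exists_dist_eq_two_mul {A : Type*} [MetricSpace A] (hA : IsGeodesicSpace A)
    (hAc : GeodesicallyComplete A) (y u : A) :
    ∃ w : A, dist u w = dist y u ∧ dist y w = 2 * dist y u := by
  obtain ⟨γ, h0, h1, hγ⟩ := hA y u
  obtain ⟨g, hg, hgγ⟩ := hAc γ 0 1 _ one_pos hγ
  have e0 : g 0 = y := (hgγ 0 (by simp)).trans h0
  have e1 : g 1 = u := (hgγ 1 (by simp)).trans h1
  refine ⟨g 2, ?_, ?_⟩
  · rw [← e1, hg 1 trivial 2 trivial, e1]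
    norm_num
  · rw [← e0, hg 0 trivial 2 trivial, e0]
    norm_num [mul_comm]

lemma exists_forall_measure_ball_pos {A : Type*} [MetricSpace A] [MeasurableSpace A]
    [SecondCountableTopology A] (μ : Measure A) {s : Set A} (hs : μ s ≠ 0) :
    ∃ x ∈ s, ∀ ε > 0, 0 < μ (Metric.ball x ε) := by
  obtain ⟨x, hxs, hx⟩ := exists_mem_forall_mem_nhdsWithin_pos_measure hs
  exact ⟨x, hxs, fun ε hε => hx _ (mem_nhdsWithin_of_mem_nhds (Metric.ball_mem_nhds x hε))⟩

lemma eq_dirac_of_ae_eq {A : Type*} [MeasurableSpace A] {μ : Measure A}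
    [IsProbabilityMeasure μ] {x : A}
    (h : ∀ᵐ y ∂μ, y = x) : μ = Measure.dirac x := by
  have h' : (fun y : A => y) =ᵐ[μ] fun _ => x := h
  have hmap : μ.map (fun y => y) = μ.map fun _ => x := Measure.map_congr h'
  rwa [Measure.map_const, measure_univ, one_smul, Measure.map_id'] at hmap

section Dirac

variable {A : Type*} [MetricSpace A] [MeasurableSpace A] [BorelSpace A]

/-- Every point of the Wasserstein space can be approximately extended, away from `μ`, to twice
its distance from `μ`. -/
def ApproxExtendible (μ : W2Space A) : Prop :=
  ∀ (ν : W2Space A) (η : ℝ), 0 < η → ∃ ν' : W2Space A,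
    4 * W2cost μ.1 ν.1 ≤ ENNReal.ofReal (1 + η) * W2cost μ.1 ν'.1 + ENNReal.ofReal η ∧
    W2cost ν.1 ν'.1 ≤ ENNReal.ofReal (1 + η) * W2cost μ.1 ν.1 + ENNReal.ofReal η

lemma integrable_dist_sq (μ : W2Space A) (x : A) : Integrable (fun y => dist x y ^ 2) μ.1 := by
  refine ⟨by fun_prop, ?_⟩
  rw [hasFiniteIntegral_iff_ofReal (ae_of_all _ fun y => by positivity)]
  simpa only [ENNReal.ofReal_pow dist_nonneg, ← edist_dist] using lintegral_edist_sq_lt_top μ x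

lemma memLp_dist (μ : W2Space A) (x : A) : MemLp (fun y => dist x y) 2 μ.1 :=
  (memLp_two_iff_integrable_sq (by fun_prop)).2 (integrable_dist_sq μ x)

lemma integrable_dist (μ : W2Space A) (x : A) : Integrable (fun y => dist x y) μ.1 :=
  have := μ.2.1
  (memLp_dist μ x).integrable one_le_two

lemma lintegral_edist_sq_eq_ofReal (μ : W2Space A) (x : A) :
    ∫⁻ y, edist x y ^ 2 ∂μ.1 = ENNReal.ofReal (∫ y, dist x y ^ 2 ∂μ.1) := by
  rw [ofReal_integral_eq_lintegral_ofReal (integrable_dist_sq μ x)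
    (ae_of_all _ fun y => by positivity)]
  simp only [ENNReal.ofReal_pow dist_nonneg, ← edist_dist]

lemma sq_integral_dist_le (μ : W2Space A) (x : A) :
    (∫ y, dist x y ∂μ.1) ^ 2 ≤ ∫ y, dist x y ^ 2 ∂μ.1 := by
  have := μ.2.1
  have h := ProbabilityTheory.variance_nonneg (fun y => dist x y) μ.1
  rw [ProbabilityTheory.variance_eq_sub (memLp_dist μ x)] at h
  simpa using h

lemma indepCost_le_ofReal (μ ν : W2Space A) (x : A) :
    indepCost μ.1 ν.1 ≤ ENNReal.ofReal (∫ y, dist x y ^ 2 ∂μ.1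
      + 2 * (∫ y, dist x y ∂μ.1) * (∫ y, dist x y ∂ν.1) + ∫ y, dist x y ^ 2 ∂ν.1) := by
  have := μ.2.1
  have := ν.2.1
  set b := ∫ y, dist x y ∂ν.1
  set c := ∫ y, dist x y ^ 2 ∂ν.1
  have hb : 0 ≤ b := integral_nonneg fun y => dist_nonneg
  have hc : 0 ≤ c := integral_nonneg fun y => by positivity
  have hinner : ∀ y, ∫⁻ z, edist y z ^ 2 ∂ν.1
      ≤ ENNReal.ofReal (dist x y ^ 2 + dist x y * (2 * b) + c) := by
    intro y
    have hi1 : Integrable (fun z => 2 * dist x y * dist x z) ν.1 :=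
      (integrable_dist ν x).const_mul _
    have hi2 : Integrable (fun z => dist x y ^ 2 + 2 * dist x y * dist x z) ν.1 :=
      (integrable_const _).add hi1
    have hi : Integrable (fun z => dist x y ^ 2 + 2 * dist x y * dist x z + dist x z ^ 2) ν.1 :=
      hi2.add (integrable_dist_sq ν x)
    calc ∫⁻ z, edist y z ^ 2 ∂ν.1
        ≤ ∫⁻ z, ENNReal.ofReal (dist x y ^ 2 + 2 * dist x y * dist x z + dist x z ^ 2) ∂ν.1 := by
          refine lintegral_mono fun z => ?_
          rw [edist_dist, ← ENNReal.ofReal_pow dist_nonneg]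
          refine ENNReal.ofReal_le_ofReal ?_
          have h := dist_triangle_left y z x
          nlinarith [dist_nonneg (x := y) (y := z)]
      _ = ENNReal.ofReal (∫ z, (dist x y ^ 2 + 2 * dist x y * dist x z + dist x z ^ 2) ∂ν.1) :=
          (ofReal_integral_eq_lintegral_ofReal hi (ae_of_all _ fun z => by positivity)).symm
      _ = ENNReal.ofReal (dist x y ^ 2 + dist x y * (2 * b) + c) := by
          rw [integral_add hi2 (integrable_dist_sq ν x),
            integral_add (integrable_const _) hi1, integral_const_mul]
          simp only [integral_const, probReal_univ, one_smul]
          congr 2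
          ring
  have hi1 : Integrable (fun y => dist x y * (2 * b)) μ.1 := (integrable_dist μ x).mul_const _
  have hi2 : Integrable (fun y => dist x y ^ 2 + dist x y * (2 * b)) μ.1 :=
    (integrable_dist_sq μ x).add hi1
  have hi : Integrable (fun y => dist x y ^ 2 + dist x y * (2 * b) + c) μ.1 :=
    hi2.add (integrable_const _)
  calc indepCost μ.1 ν.1
      ≤ ∫⁻ y, ENNReal.ofReal (dist x y ^ 2 + dist x y * (2 * b) + c) ∂μ.1 := lintegral_mono hinner
    _ = ENNReal.ofReal (∫ y, (dist x y ^ 2 + dist x y * (2 * b) + c) ∂μ.1) :=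
        (ofReal_integral_eq_lintegral_ofReal hi (ae_of_all _ fun z => by positivity)).symm
    _ = _ := by
        rw [integral_add hi2 (integrable_const _),
          integral_add (integrable_dist_sq μ x) hi1, integral_mul_const]
        simp only [integral_const, probReal_univ, one_smul]
        congr 2
        ring

variable [SecondCountableTopology A]

lemma ApproxExtendible.integral_dist_sq_le {μ : W2Space A} (hμ : ApproxExtendible μ) (x : A) :
    ∫ y, dist x y ^ 2 ∂μ.1 ≤ (∫ y, dist x y ∂μ.1) ^ 2 := by
  have := μ.2.1
  set D := ∫ y, dist x y ^ 2 ∂μ.1 with hD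
  set a := ∫ y, dist x y ∂μ.1 with ha
  have hD0 : 0 ≤ D := integral_nonneg fun y => by positivity
  have ha0 : 0 ≤ a := integral_nonneg fun y => dist_nonneg
  have key : ∀ η : ℝ, 0 < η → 4 * D ≤ (1 + η) *
      (D + 2 * a * √((1 + η) * D + η) + ((1 + η) * D + η)) + η := by
    intro η hη
    obtain ⟨ν', h1, h2⟩ := hμ (diracW2 x) η hη
    have := ν'.2.1
    set B := ∫ y, dist x y ^ 2 ∂ν'.1 with hB
    set b := ∫ y, dist x y ∂ν'.1 with hb
    have hb0 : 0 ≤ b := integral_nonneg fun y => dist_nonneg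
    have hB0 : 0 ≤ B := integral_nonneg fun y => by positivity
    have hC : W2cost μ.1 (diracW2 x).1 = ENNReal.ofReal D := by
      rw [← lintegral_edist_sq_eq_ofReal]
      exact W2cost_dirac_right _ _
    have hC' : W2cost (diracW2 x).1 ν'.1 = ENNReal.ofReal B := by
      rw [← lintegral_edist_sq_eq_ofReal]
      exact W2cost_dirac_left _ _
    rw [hC, hC', ← ENNReal.ofReal_mul (by positivity),
      ← ENNReal.ofReal_add (by positivity) hη.le,
      ENNReal.ofReal_le_ofReal_iff (by positivity)] at h2
    have hI := (W2cost_le_indepCost μ.1 ν'.1).trans (indepCost_le_ofReal μ ν' x)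
    have h3 : (4 : ℝ≥0∞) * ENNReal.ofReal D ≤ ENNReal.ofReal (1 + η)
        * ENNReal.ofReal (D + 2 * a * b + B) + ENNReal.ofReal η := by
      rw [← hC]
      exact h1.trans (by gcongr)
    rw [← ENNReal.ofReal_mul (by positivity), ← ENNReal.ofReal_add (by positivity) hη.le,
      ← ENNReal.ofReal_ofNat, ← ENNReal.ofReal_mul (by positivity),
      ENNReal.ofReal_le_ofReal_iff (by positivity)] at h3
    have hbB : b ≤ √((1 + η) * D + η) := by
      refine Real.le_sqrt_of_sq_le ((sq_integral_dist_le ν' x).trans h2)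
    calc 4 * D ≤ (1 + η) * (D + 2 * a * b + B) + η := h3
      _ ≤ _ := by gcongr
  have hlim : Tendsto (fun η : ℝ => (1 + η) *
      (D + 2 * a * √((1 + η) * D + η) + ((1 + η) * D + η)) + η) (𝓝[>] 0)
      (𝓝 ((1 + 0) * (D + 2 * a * √((1 + 0) * D + 0) + ((1 + 0) * D + 0)) + 0)) := by
    refine tendsto_nhdsWithin_of_tendsto_nhds (Continuous.tendsto ?_ 0)
    fun_prop
  have hle : 4 * D ≤ (1 + 0) * (D + 2 * a * √((1 + 0) * D + 0) + ((1 + 0) * D + 0)) + 0 :=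
    ge_of_tendsto hlim (by filter_upwards [self_mem_nhdsWithin] with η hη using key η hη)
  simp only [add_zero, one_mul] at hle
  have hs := Real.sq_sqrt hD0
  have hs0 := Real.sqrt_nonneg D
  rcases hs0.eq_or_lt with h0 | h0
  · rw [← hs, ← h0]
    simpa using sq_nonneg a
  · have : √D ≤ a := by nlinarith
    rw [← hs]
    gcongr

/-- Only Dirac masses are approximately extendible. -/
lemma ApproxExtendible.exists_eq_dirac {μ : W2Space A} (hμ : ApproxExtendible μ) :
    ∃ x : A, μ = diracW2 x := by
  have := μ.2.1
  obtain ⟨x, -, hx⟩ := exists_forall_measure_ball_pos μ.1 (s := univ) (by simp)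
  refine ⟨x, Subtype.ext ?_⟩
  have hvar : ProbabilityTheory.variance (fun y => dist x y) μ.1 = 0 := by
    refine le_antisymm ?_ (ProbabilityTheory.variance_nonneg _ _)
    rw [ProbabilityTheory.variance_eq_sub (memLp_dist μ x)]
    simpa using hμ.integral_dist_sq_le x
  have hae : ∀ᵐ y ∂μ.1, dist x y = ∫ z, dist x z ∂μ.1 := by
    refine (ProbabilityTheory.evariance_eq_zero_iff (by fun_prop)).1 ?_
    rw [← (memLp_dist μ x).ofReal_variance_eq, hvar, ENNReal.ofReal_zero]
  have hle : ∫ z, dist x z ∂μ.1 ≤ 0 := by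
    refine le_of_forall_pos_le_add fun ε hε => ?_
    obtain ⟨y, hy1, hy2⟩ := ((frequently_ae_mem_iff.2 (hx ε hε).ne').and_eventually hae).exists
    rw [← hy2, zero_add, dist_comm]
    exact (Metric.mem_ball.1 hy1).le
  refine eq_dirac_of_ae_eq ?_
  filter_upwards [hae] with y hy
  exact (dist_le_zero.1 (hy.trans_le hle)).symm

/-- A measurable approximate extension of the geodesics issued from a given point. -/
lemma exists_measurable_extension (hA : IsGeodesicSpace A) (hAc : GeodesicallyComplete A)
    (y : A) {s : ℝ} (hs : 0 < s) :
    ∃ T : A → A, Measurable T ∧ ∀ x, dist x (T x) ≤ dist y x + 2 * s ∧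
      2 * dist y x ≤ dist y (T x) + 2 * s := by
  classical
  have : Nonempty A := ⟨y⟩
  choose ext hext1 hext2 using exists_dist_eq_two_mul hA hAc y
  obtain ⟨u, hu⟩ := TopologicalSpace.exists_dense_seq A
  have hex : ∀ x : A, ∃ n, dist x (u n) < s := fun x => by
    obtain ⟨_, hz, n, rfl⟩ := Metric.dense_iff.1 hu x s hs
    exact ⟨n, by rwa [dist_comm]⟩
  have hN : Measurable fun x => Nat.find (hex x) :=
    measurable_find hex fun k => measurableSet_lt (by fun_prop) measurable_const
  refine ⟨fun x => ext (u (Nat.find (hex x))),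
    (measurable_from_nat (f := fun n => ext (u n))).comp hN, fun x => ?_⟩
  have hx := Nat.find_spec (hex x)
  set v := u (Nat.find (hex x))
  have h1 := dist_triangle x v (ext v)
  have h2 := dist_triangle y x v
  have h3 := dist_triangle_right y x v
  rw [hext2]
  rw [hext1] at h1
  constructor <;> linarith

lemma approxExtendible_diracW2 (hA : IsGeodesicSpace A) (hAc : GeodesicallyComplete A) (y : A) :
    ApproxExtendible (diracW2 y) := by
  intro ν η hη
  have := ν.2.1
  set s := min (η / 8) 1 with hs
  have hs0 : 0 < s := by positivity
  have hs1 : s ≤ 1 := min_le_right _ _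
  have hs2 : s ≤ η / 8 := min_le_left _ _
  obtain ⟨T, hT, hTx⟩ := exists_measurable_extension hA hAc y hs0
  have hineq : ∀ d e : ℝ, 0 ≤ d → 0 ≤ e → d ≤ e + 2 * s → d ^ 2 ≤ (1 + η) * e ^ 2 + η := by
    intro d e hd he h
    have : d ^ 2 ≤ (e + 2 * s) ^ 2 := by gcongr
    nlinarith [sq_nonneg (e - 1), mul_nonneg hs0.le (sq_nonneg (e - 1)),
      mul_le_mul_of_nonneg_right hs2 (sq_nonneg e)]
  have hineq' : ∀ d e : ℝ, 0 ≤ d → 0 ≤ e → d ≤ e + 2 * s → ENNReal.ofReal d ^ 2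
      ≤ ENNReal.ofReal (1 + η) * ENNReal.ofReal e ^ 2 + ENNReal.ofReal η := by
    intro d e hd he h
    rw [← ENNReal.ofReal_pow hd, ← ENNReal.ofReal_pow he, ← ENNReal.ofReal_mul (by positivity),
      ← ENNReal.ofReal_add (by positivity) hη.le]
    exact ENNReal.ofReal_le_ofReal (hineq d e hd he h)
  have hp : IsProbabilityMeasure (ν.1.map T) := Measure.isProbabilityMeasure_map hT.aemeasurable
  have hpush : ∫⁻ z, edist y z ^ 2 ∂(ν.1.map T) = ∫⁻ x, edist y (T x) ^ 2 ∂ν.1 :=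
    lintegral_map (measurable_edist_sq_left y) hT
  have hmT : Measurable fun x => edist x (T x) ^ 2 := by fun_prop
  have hmy := measurable_edist_sq_left y
  have hmT' : Measurable fun x => edist y (T x) ^ 2 := by fun_prop
  have hbound : ∫⁻ x, edist x (T x) ^ 2 ∂ν.1
      ≤ ENNReal.ofReal (1 + η) * ∫⁻ x, edist y x ^ 2 ∂ν.1 + ENNReal.ofReal η := by
    calc ∫⁻ x, edist x (T x) ^ 2 ∂ν.1
        ≤ ∫⁻ x, (ENNReal.ofReal (1 + η) * edist y x ^ 2 + ENNReal.ofReal η) ∂ν.1 := by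
          refine lintegral_mono fun x => ?_
          simp only [edist_dist]
          exact hineq' _ _ dist_nonneg dist_nonneg (hTx x).1
      _ = _ := by
          rw [lintegral_add_right _ measurable_const, lintegral_const_mul _ hmy]
          simp
  have hνfin := lintegral_edist_sq_lt_top ν y
  have hmem : ∫⁻ z, edist y z ^ 2 ∂(ν.1.map T) < ⊤ := by
    rw [hpush]
    calc ∫⁻ x, edist y (T x) ^ 2 ∂ν.1
        ≤ ∫⁻ x, (2 * edist y x ^ 2 + 2 * edist x (T x) ^ 2) ∂ν.1 :=
          lintegral_mono fun x => edist_sq_le_two_mul y x (T x)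
      _ = 2 * ∫⁻ x, edist y x ^ 2 ∂ν.1 + 2 * ∫⁻ x, edist x (T x) ^ 2 ∂ν.1 := by
          rw [lintegral_add_left (hmy.const_mul _), lintegral_const_mul _ hmy,
            lintegral_const_mul _ hmT]
      _ < ⊤ := by
          have := hbound.trans_lt (by finiteness)
          finiteness
  refine ⟨⟨ν.1.map T, hp, y, by simpa only [← edist_dist] using hmem⟩, ?_, ?_⟩
  · change 4 * W2cost (Measure.dirac y) ν.1 ≤ _ * W2cost (Measure.dirac y) (ν.1.map T) + _
    rw [W2cost_dirac_left, W2cost_dirac_left, hpush]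
    calc 4 * ∫⁻ x, edist y x ^ 2 ∂ν.1 = ∫⁻ x, 4 * edist y x ^ 2 ∂ν.1 :=
          (lintegral_const_mul _ hmy).symm
      _ ≤ ∫⁻ x, (ENNReal.ofReal (1 + η) * edist y (T x) ^ 2 + ENNReal.ofReal η) ∂ν.1 := by
          refine lintegral_mono fun x => ?_
          simp only [edist_dist]
          refine le_trans (le_of_eq ?_) (hineq' (2 * dist y x) _ (by positivity) dist_nonneg
            (hTx x).2)
          rw [ENNReal.ofReal_mul two_pos.le, mul_pow]
          norm_num
      _ = _ := by
          rw [lintegral_add_right _ measurable_const, lintegral_const_mul _ hmT']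
          simp
  · change W2cost ν.1 (ν.1.map T) ≤ _ * W2cost (Measure.dirac y) ν.1 + _
    rw [W2cost_dirac_left]
    have hcoup : IsCoupling (ν.1.map fun x => (x, T x)) ν.1 (ν.1.map T) := by
      constructor
      · rw [Measure.map_map measurable_fst (by fun_prop)]
        exact Measure.map_id
      · rw [Measure.map_map measurable_snd (by fun_prop)]
        rfl
    refine (W2cost_le hcoup).trans ?_
    rwa [lintegral_map measurable_edist_sq (by fun_prop)]

end Dirac

section Pushforward

variable {A B : Type*} [MetricSpace A] [MeasurableSpace A] [BorelSpace A]
  [MetricSpace B] [MeasurableSpace B] [BorelSpace B]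

lemma lintegral_edist_sq_map {i : A → B} (hi : Isometry i) (μ : Measure A) (x : A) :
    ∫⁻ z, edist (i x) z ^ 2 ∂(μ.map i) = ∫⁻ y, edist x y ^ 2 ∂μ := by
  rw [lintegral_map (measurable_edist_sq_left _) hi.continuous.measurable]
  simp only [hi.edist_eq]

/-- Pushforward of points of the Wasserstein space by an isometric embedding. -/
def mapW2 (i : A → B) (hi : Isometry i) (μ : W2Space A) : W2Space B :=
  ⟨μ.1.map i,
    have := μ.2.1
    Measure.isProbabilityMeasure_map hi.continuous.measurable.aemeasurable, by
    obtain ⟨x₀, h⟩ := μ.2.2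
    refine ⟨i x₀, ?_⟩
    simp only [← edist_dist] at h ⊢
    rwa [lintegral_edist_sq_map hi]⟩

variable [SecondCountableTopology A] [SecondCountableTopology B]

omit [SecondCountableTopology A] in
lemma W2cost_map_le {i : A → B} (hi : Isometry i) (μ ν : Measure A) :
    W2cost (μ.map i) (ν.map i) ≤ W2cost μ ν := by
  have him := hi.continuous.measurable
  refine le_W2cost fun π hπ => ?_
  have hcoup : IsCoupling (π.map (Prod.map i i)) (μ.map i) (ν.map i) := by
    constructor
    · rw [Measure.map_map measurable_fst (him.prodMap him), ← hπ.1,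
        Measure.map_map him measurable_fst]
      rfl
    · rw [Measure.map_map measurable_snd (him.prodMap him), ← hπ.2,
        Measure.map_map him measurable_snd]
      rfl
  refine (W2cost_le hcoup).trans_eq ?_
  rw [lintegral_map measurable_edist_sq (him.prodMap him)]
  simp [hi.edist_eq]

lemma W2cost_map [CompleteSpace A] [Nonempty A] {i : A → B} (hi : Isometry i)
    (μ ν : Measure A) : W2cost (μ.map i) (ν.map i) = W2cost μ ν := by
  refine le_antisymm (W2cost_map_le hi μ ν) (le_W2cost fun π hπ => ?_)
  have hie : MeasurableEmbedding i := hi.isClosedEmbedding.measurableEmbedding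
  obtain ⟨g, hg, hgi⟩ := hie.exists_measurable_extend measurable_id fun _ => ‹Nonempty A›
  have hgμ : ∀ ρ : Measure A, (ρ.map i).map g = ρ := fun ρ => by
    rw [Measure.map_map hg hie.measurable, hgi, Measure.map_id]
  have hcoup : IsCoupling (π.map (Prod.map g g)) μ ν := by
    constructor
    · rw [Measure.map_map measurable_fst (hg.prodMap hg), ← hgμ μ, ← hπ.1,
        Measure.map_map hg measurable_fst]
      rfl
    · rw [Measure.map_map measurable_snd (hg.prodMap hg), ← hgμ ν, ← hπ.2,
        Measure.map_map hg measurable_snd]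
      rfl
  refine (W2cost_le hcoup).trans_eq ?_
  rw [lintegral_map measurable_edist_sq (hg.prodMap hg)]
  have hrange : ∀ ρ : Measure A, ∀ᵐ z ∂(ρ.map i), z ∈ range i := fun ρ =>
    ae_map_mem_range i hie.measurableSet_range ρ
  have h1 : ∀ᵐ p ∂π, p.1 ∈ range i :=
    ae_of_ae_map measurable_fst.aemeasurable (hπ.1.symm ▸ hrange μ)
  have h2 : ∀ᵐ p ∂π, p.2 ∈ range i :=
    ae_of_ae_map measurable_snd.aemeasurable (hπ.2.symm ▸ hrange ν)
  refine lintegral_congr_ae ?_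
  filter_upwards [h1, h2] with p ⟨x, hx⟩ ⟨y, hy⟩
  have hgx : ∀ x, g (i x) = x := congrFun hgi
  simp only [Prod.map_fst, Prod.map_snd, ← hx, ← hy, hgx, hi.edist_eq]

lemma exists_W2Space_equiv_of_isometryEquiv (e : A ≃ᵢ B) :
    ∃ F : W2Space A ≃ W2Space B, ∀ μ ν : W2Space A, Wdist (F μ) (F ν) = Wdist μ ν := by
  refine ⟨⟨mapW2 e e.isometry, mapW2 e.symm e.symm.isometry, fun μ => Subtype.ext ?_,
    fun μ => Subtype.ext ?_⟩, fun μ ν => (Wdist_eq_Wdist_iff _ _ _ _).2 ?_⟩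
  · change (μ.1.map e).map e.symm = μ.1
    rw [Measure.map_map e.symm.continuous.measurable e.continuous.measurable,
      e.symm_comp_self, Measure.map_id]
  · change (μ.1.map e.symm).map e = μ.1
    rw [Measure.map_map e.continuous.measurable e.symm.continuous.measurable,
      e.self_comp_symm, Measure.map_id]
  · change W2cost (μ.1.map e) (ν.1.map e) = W2cost μ.1 ν.1
    refine le_antisymm (W2cost_map_le e.isometry _ _) ?_
    have h := W2cost_map_le e.symm.isometry (μ.1.map e) (ν.1.map e)
    rw [Measure.map_map e.symm.continuous.measurable e.continuous.measurable,
      Measure.map_map e.symm.continuous.measurable e.continuous.measurable,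
      e.symm_comp_self, Measure.map_id, Measure.map_id] at h
    exact h

end Pushforward

section WassersteinIsometry

variable {A B : Type*} [MetricSpace A] [MeasurableSpace A] [BorelSpace A]
  [SecondCountableTopology A] [MetricSpace B] [MeasurableSpace B] [BorelSpace B]
  [SecondCountableTopology B]

omit [BorelSpace A] [SecondCountableTopology A] [BorelSpace B] [SecondCountableTopology B] in
lemma ApproxExtendible.map_equiv {F : W2Space A ≃ W2Space B}
    (hF : ∀ μ ν, W2cost (F μ).1 (F ν).1 = W2cost μ.1 ν.1) {μ : W2Space A}
    (hμ : ApproxExtendible μ) : ApproxExtendible (F μ) := by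
  intro ν η hη
  obtain ⟨ν', h1, h2⟩ := hμ (F.symm ν) η hη
  refine ⟨F ν', ?_, ?_⟩
  · rwa [← hF, ← hF, F.apply_symm_apply] at h1
  · rwa [← hF, ← hF, F.apply_symm_apply] at h2

lemma exists_isometry_forall_map_dirac (hA : IsGeodesicSpace A) (hAc : GeodesicallyComplete A)
    {F : W2Space A ≃ W2Space B} (hF : ∀ μ ν, W2cost (F μ).1 (F ν).1 = W2cost μ.1 ν.1) :
    ∃ i : A → B, Isometry i ∧ ∀ y, F (diracW2 y) = diracW2 (i y) := by
  choose i hi using fun y =>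
    ((approxExtendible_diracW2 hA hAc y).map_equiv hF).exists_eq_dirac
  refine ⟨i, fun x y => ?_, hi⟩
  have h := hF (diracW2 x) (diracW2 y)
  rw [hi, hi] at h
  have h' : edist (i x) (i y) ^ 2 = edist x y ^ 2 := by
    simpa only [W2cost_dirac_dirac] using
      (W2cost_dirac_dirac (i x) (i y)).symm.trans (h.trans (W2cost_dirac_dirac x y))
  exact (ENNReal.pow_right_strictMono two_ne_zero).injective h'

/-- The measures on `A` obtained from the Dirac masses of `B` by iterating the isometric
embedding `F⁻¹ ∘ i_*` of the Wasserstein space of `A` into itself. -/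
def iteratedPullback (F : W2Space A ≃ W2Space B) (i : A → B) (hi : Isometry i) (k : ℕ) (w : B) :
    W2Space A :=
  (fun α => F.symm (mapW2 i hi α))^[k] (F.symm (diracW2 w))

variable {F : W2Space A ≃ W2Space B} {i : A → B} {hi : Isometry i}

omit [SecondCountableTopology A] [SecondCountableTopology B] in
lemma iteratedPullback_succ (k : ℕ) (w : B) : iteratedPullback F i hi (k + 1) w
    = F.symm (mapW2 i hi (iteratedPullback F i hi k w)) :=
  Function.iterate_succ_apply' _ _ _

variable (hF : ∀ μ ν, W2cost (F μ).1 (F ν).1 = W2cost μ.1 ν.1)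
  (hFi : ∀ y, F (diracW2 y) = diracW2 (i y))

include hF

omit [BorelSpace A] [SecondCountableTopology A] [BorelSpace B] [SecondCountableTopology B] in
lemma W2cost_symm (μ ν : W2Space B) : W2cost (F.symm μ).1 (F.symm ν).1 = W2cost μ.1 ν.1 := by
  rw [← hF, F.apply_symm_apply, F.apply_symm_apply]

lemma W2cost_iteratedPullback_add [CompleteSpace A] [Nonempty A] (k l : ℕ) (w w' : B) :
    W2cost (iteratedPullback F i hi (l + k) w).1 (iteratedPullback F i hi k w').1
      = W2cost (iteratedPullback F i hi l w).1 (F.symm (diracW2 w')).1 := by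
  induction k with
  | zero => rfl
  | succ k ih =>
    rw [← add_assoc, iteratedPullback_succ, iteratedPullback_succ, W2cost_symm hF, ← ih]
    exact W2cost_map hi _ _

lemma W2cost_iteratedPullback_self [CompleteSpace A] [Nonempty A] (k : ℕ) (w w' : B) :
    W2cost (iteratedPullback F i hi k w).1 (iteratedPullback F i hi k w').1
      = edist w w' ^ 2 := by
  have h := W2cost_iteratedPullback_add (hi := hi) hF k 0 w w'
  rw [zero_add] at h
  rw [h]
  exact (W2cost_symm hF _ _).trans (W2cost_dirac_dirac w w')

include hFi

lemma lintegral_edist_sq_symm (μ : W2Space B) (y : A) :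
    ∫⁻ x, edist y x ^ 2 ∂(F.symm μ).1 = ∫⁻ z, edist (i y) z ^ 2 ∂μ.1 := by
  have := μ.2.1
  have := (F.symm μ).2.1
  rw [← W2cost_dirac_left, ← W2cost_dirac_left]
  have h := hF (diracW2 y) (F.symm μ)
  rw [hFi, F.apply_symm_apply] at h
  exact h.symm

lemma lintegral_edist_sq_iteratedPullback (k : ℕ) (w : B) (y : A) :
    ∫⁻ x, edist y x ^ 2 ∂(iteratedPullback F i hi k w).1 = edist (i y) w ^ 2 := by
  induction k with
  | zero =>
    refine (lintegral_edist_sq_symm hF hFi _ y).trans ?_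
    exact lintegral_dirac' _ (measurable_edist_sq_left _)
  | succ k ih =>
    rw [iteratedPullback_succ, lintegral_edist_sq_symm hF hFi, ← ih]
    exact lintegral_edist_sq_map hi _ y

lemma indepCost_iteratedPullback (k : ℕ) (w : B) (μ : W2Space A) :
    indepCost μ.1 (iteratedPullback F i hi k w).1 = ∫⁻ y, edist (i y) w ^ 2 ∂μ.1 :=
  lintegral_congr fun y => lintegral_edist_sq_iteratedPullback hF hFi k w y

lemma W2cost_iteratedPullback_of_lt [CompleteSpace A] [Nonempty A] {j k : ℕ} (hjk : j < k)
    (w w' : B) :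
    W2cost (iteratedPullback F i hi k w).1 (iteratedPullback F i hi j w').1
      = indepCost (iteratedPullback F i hi k w).1 (iteratedPullback F i hi j w').1 := by
  obtain ⟨l, rfl⟩ := Nat.exists_eq_add_of_lt hjk
  have hprob : ∀ k w, IsProbabilityMeasure (iteratedPullback F i hi k w).1 := fun k w =>
    (iteratedPullback F i hi k w).2.1
  have := (mapW2 i hi (iteratedPullback F i hi l w)).2.1
  have hswap : ∀ k w l w', indepCost (iteratedPullback F i hi k w).1
      (iteratedPullback F i hi l w').1 = indepCost (iteratedPullback F i hi 0 w).1
      (iteratedPullback F i hi 0 w').1 := fun k w l w' => by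
    rw [indepCost_iteratedPullback hF hFi l, ← indepCost_iteratedPullback (hi := hi) hF hFi 0 w',
      indepCost_comm, indepCost_iteratedPullback hF hFi k,
      ← indepCost_iteratedPullback (hi := hi) hF hFi 0 w, indepCost_comm]
  rw [show j + l + 1 = l + 1 + j by ring, W2cost_iteratedPullback_add hF, hswap,
    iteratedPullback_succ, W2cost_symm hF, ← hswap l w 0 w', indepCost_iteratedPullback hF hFi]
  refine (W2cost_dirac_right _ _).trans ?_
  refine (lintegral_map (measurable_edist_sq_left _) hi.continuous.measurable).trans ?_
  exact lintegral_congr fun x => by rw [edist_comm]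

lemma W2cost_iteratedPullback_of_ne [CompleteSpace A] [Nonempty A] {j k : ℕ} (hjk : j ≠ k)
    (w w' : B) :
    W2cost (iteratedPullback F i hi k w).1 (iteratedPullback F i hi j w').1
      = indepCost (iteratedPullback F i hi k w).1 (iteratedPullback F i hi j w').1 := by
  rcases hjk.lt_or_gt with h | h
  · exact W2cost_iteratedPullback_of_lt hF hFi h w w'
  · have := (iteratedPullback F i hi k w).2.1
    have := (iteratedPullback F i hi j w').2.1
    rw [W2cost_comm, indepCost_comm]
    exact W2cost_iteratedPullback_of_lt hF hFi h w' w

end WassersteinIsometry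

lemma IsGeodesicSpace.preconnectedSpace {B : Type*} [MetricSpace B] (hB : IsGeodesicSpace B) :
    PreconnectedSpace B := by
  constructor
  rcases isEmpty_or_nonempty B with h | ⟨⟨x⟩⟩
  · exact fun _ _ _ _ _ ⟨x, _⟩ => isEmptyElim x
  refine isPreconnected_of_forall x fun y _ => ?_
  obtain ⟨γ, h0, h1, hγ⟩ := hB x y
  refine ⟨γ '' Icc 0 1, subset_univ _, ⟨0, by simp, h0⟩, ⟨1, by simp, h1⟩,
    isPreconnected_Icc.image _ ?_⟩
  refine LipschitzOnWith.continuousOn (K := (dist x y).toNNReal)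
    (LipschitzOnWith.of_dist_le_mul fun s hs t ht => ?_)
  rw [hγ s hs t ht, Real.coe_toNNReal _ dist_nonneg, Real.dist_eq]

lemma Isometry.exists_forall_exists_dist_lt {A B : Type*} [MetricSpace A] [CompleteSpace A]
    [Nonempty A] [MetricSpace B] [PreconnectedSpace B] {i : A → B} (hi : Isometry i)
    (hs : ¬ Function.Surjective i) :
    ∃ y, ∀ ρ > 0, ∃ w ∉ range i, dist (i y) w < ρ := by
  by_contra! h
  refine hs (range_eq_univ.1 (IsClopen.eq_univ ⟨hi.isClosedEmbedding.isClosed_range, ?_⟩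
    (range_nonempty i)))
  rw [Metric.isOpen_iff]
  rintro _ ⟨y, rfl⟩
  obtain ⟨ρ, hρ, H⟩ := h y
  refine ⟨ρ, hρ, fun w hw => ?_⟩
  by_contra hwr
  exact (H w hwr).not_gt (by rwa [dist_comm])

section Support

variable {A : Type*} [MetricSpace A] [MeasurableSpace A] [BorelSpace A]
  [SecondCountableTopology A]

omit [BorelSpace A] in
lemma exists_dist_lt_forall_measure_ball_pos {lam : Measure A} [IsProbabilityMeasure lam]
    {p : A} {r : ℝ} (h : ∫⁻ y, edist p y ^ 2 ∂lam < ENNReal.ofReal r ^ 2) :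
    ∃ q, dist p q < r ∧ ∀ ε > 0, 0 < lam (Metric.ball q ε) := by
  suffices hs : lam {q | dist p q < r} ≠ 0 by
    obtain ⟨q, hq, H⟩ := exists_forall_measure_ball_pos lam hs
    exact ⟨q, hq, H⟩
  intro h0
  refine h.not_ge ?_
  calc ENNReal.ofReal r ^ 2 = ∫⁻ _, ENNReal.ofReal r ^ 2 ∂lam := by simp
    _ ≤ ∫⁻ y, edist p y ^ 2 ∂lam := by
      refine lintegral_mono_ae ?_
      filter_upwards [measure_eq_zero_iff_ae_notMem.1 h0] with y hy
      rw [edist_dist]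
      gcongr
      exact not_lt.1 hy

omit [BorelSpace A] in
lemma exists_le_dist_forall_measure_ball_pos {lam : Measure A} [IsProbabilityMeasure lam]
    {p : A} {r : ℝ} (h : ENNReal.ofReal r ^ 2 < ∫⁻ y, edist p y ^ 2 ∂lam) :
    ∃ q, r ≤ dist p q ∧ ∀ ε > 0, 0 < lam (Metric.ball q ε) := by
  suffices hs : lam {q | r ≤ dist p q} ≠ 0 by
    obtain ⟨q, hq, H⟩ := exists_forall_measure_ball_pos lam hs
    exact ⟨q, hq, H⟩
  intro h0
  refine h.not_ge ?_
  calc ∫⁻ y, edist p y ^ 2 ∂lam ≤ ∫⁻ _, ENNReal.ofReal r ^ 2 ∂lam := by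
        refine lintegral_mono_ae ?_
        filter_upwards [measure_eq_zero_iff_ae_notMem.1 h0] with y hy
        rw [edist_dist]
        gcongr
        exact (not_le.1 hy).le
    _ = ENNReal.ofReal r ^ 2 := by simp

/-- Among infinitely many measures charging both a small ball around `p` and a thin annulus
around a compact sphere centered at `p`, two are not optimally coupled by their product. -/
lemma exists_ne_W2cost_lt_indepCost {ν : ℕ → W2Space A} {p : A} {δ : ℝ} (hδ : 0 < δ)
    (hcomp : IsCompact (Metric.closedBall p (40 * δ)))
    (hball : ∀ n, 0 < (ν n).1 (Metric.ball p (2 * δ)))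
    (hann : ∀ n, 0 < (ν n).1 {x | |dist p x - 20 * δ| < δ}) :
    ∃ m n, m ≠ n ∧ W2cost (ν m).1 (ν n).1 < indepCost (ν m).1 (ν n).1 := by
  obtain ⟨t, -, htfin, htcover⟩ := hcomp.finite_cover_balls hδ
  have hv : ∀ n, ∃ v ∈ t, 18 * δ ≤ dist p v ∧ 0 < (ν n).1 (Metric.ball v (2 * δ)) := fun n => by
    obtain ⟨x, hx, hxpos⟩ := exists_forall_measure_ball_pos (ν n).1 (hann n).ne'
    rw [mem_ofPred_eq, abs_lt] at hx
    obtain ⟨v, hvt, hxv⟩ := mem_iUnion₂.1 (htcover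
      (show x ∈ Metric.closedBall p (40 * δ) by rw [Metric.mem_closedBall']; linarith))
    rw [Metric.mem_ball] at hxv
    refine ⟨v, hvt, ?_, (hxpos δ hδ).trans_le (measure_mono (Metric.ball_subset_ball' ?_))⟩
    · linarith [dist_triangle_right p x v, dist_triangle p v x, dist_comm x v]
    · linarith
  choose v hvt hpv hvpos using hv
  obtain ⟨m, -, n, -, hmn, hvmn⟩ :=
    infinite_univ.exists_ne_map_eq_of_mapsTo (f := v) (fun n _ => hvt n) htfin
  have := (ν m).2.1
  have := (ν n).2.1
  exact ⟨m, n, hmn, W2cost_lt_indepCost (indepCost_lt_top _ _).ne (by positivity : 0 < 2 * δ)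
    (by linarith [hpv m]) (hball m) (hvpos m) (hball n) (hvmn ▸ hvpos n)⟩

end Support

section Surjectivity

variable {A B : Type*} [MetricSpace A] [MeasurableSpace A] [BorelSpace A]
  [SecondCountableTopology A] [CompleteSpace A] [MetricSpace B] [MeasurableSpace B]
  [BorelSpace B] [SecondCountableTopology B]

lemma mem_range_of_isCompact_closedBall [LocallyCompactSpace A] (hB : IsGeodesicSpace B)
    {F : W2Space A ≃ W2Space B} (hF : ∀ μ ν, W2cost (F μ).1 (F ν).1 = W2cost μ.1 ν.1)
    {i : A → B} (hi : Isometry i) (hFi : ∀ y, F (diracW2 y) = diracW2 (i y))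
    {y : A} {ρ : ℝ} (hcomp : IsCompact (Metric.closedBall y ρ)) {w : B}
    (hw : dist (i y) w < ρ) : w ∈ range i := by
  by_contra hwr
  have : Nonempty A := ⟨y⟩
  set L : ℕ → B → W2Space A := fun k w => iteratedPullback F i hi k w with hL
  have hprob : ∀ k w, IsProbabilityMeasure (L k w).1 := fun k w => (L k w).2.1
  have hmoment : ∀ k w y, ∫⁻ x, edist y x ^ 2 ∂(L k w).1 = ENNReal.ofReal (dist (i y) w) ^ 2 :=
    fun k w y => by rw [← edist_dist]; exact lintegral_edist_sq_iteratedPullback hF hFi k w y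
  have hsupp : ∀ k, ∃ q, dist y q < ρ ∧ ∀ ε > 0, 0 < (L k w).1 (Metric.ball q ε) := fun k =>
    exists_dist_lt_forall_measure_ball_pos <| by
      rw [hmoment]
      exact ENNReal.pow_lt_pow_left two_ne_zero
        ((ENNReal.ofReal_lt_ofReal_iff (dist_nonneg.trans_lt hw)).2 hw)
  choose q hq hqpos using hsupp
  obtain ⟨p, -, φ, hφ, hlim⟩ := hcomp.tendsto_subseq
    (fun k => Metric.mem_closedBall'.2 (hq k).le)
  set σ := dist (i p) w with hσ
  have hσ0 : 0 < σ := dist_pos.2 fun h => hwr ⟨p, h⟩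
  have hfar : ∀ k, ∃ q, σ / 2 ≤ dist p q ∧ ∀ ε > 0, 0 < (L k w).1 (Metric.ball q ε) := fun k =>
    exists_le_dist_forall_measure_ball_pos <| by
      rw [hmoment]
      exact ENNReal.pow_lt_pow_left two_ne_zero
        ((ENNReal.ofReal_lt_ofReal_iff hσ0).2 (half_lt_self hσ0))
  choose r hr hrpos using hfar
  obtain ⟨R, hR, hRcomp⟩ := Metric.exists_isCompact_closedBall p
  set δ := min (R / 40) (σ / 40) with hδ_def
  have hδ : 0 < δ := lt_min (by positivity) (by positivity)
  have hδR : 40 * δ ≤ R := by linarith [min_le_left (R / 40) (σ / 40)]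
  have hδσ : 40 * δ ≤ σ := by linarith [min_le_right (R / 40) (σ / 40)]
  obtain ⟨N, hN⟩ := Metric.tendsto_atTop.1 hlim δ hδ
  obtain ⟨β, hβ0, hβ1, hβ⟩ := hB (i p) w
  set t : ℕ → ℝ := fun k => 20 * δ / dist p (r k) with ht
  have hr0 : ∀ k, 0 < dist p (r k) := fun k => (half_pos hσ0).trans_le (hr k)
  have ht0 : ∀ k, 0 < t k := fun k => div_pos (by positivity) (hr0 k)
  have ht1 : ∀ k, t k ≤ 1 := fun k => (div_le_one (hr0 k)).2 (by linarith [hr k])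
  have hmem : ∀ k, t k ∈ Icc (0 : ℝ) 1 := fun k => ⟨(ht0 k).le, ht1 k⟩
  have hdist0 : ∀ k, dist (i p) (β (t k)) = t k * σ := fun k => by
    conv_lhs => rw [← hβ0]
    rw [hβ 0 (by simp) _ (hmem k), zero_sub, abs_neg, abs_of_pos (ht0 k), mul_comm]
  have hdist1 : ∀ k, dist (β (t k)) w = (1 - t k) * σ := fun k => by
    conv_lhs => rw [← hβ1]
    rw [hβ _ (hmem k) 1 (by simp), abs_sub_comm, abs_of_nonneg (by linarith [ht1 k]), mul_comm]
  have hannulus : ∀ k z, (∀ ε > 0, 0 < (L k w).1 (Metric.ball z ε)) →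
      0 < (L k (β (t k))).1 {x | |dist p x - t k * dist p z| < δ} := fun k z hz => by
    refine measure_annulus_pos_of_interpolation (ht0 k) (ht1 k) (lam := (L k w).1)
      (lintegral_edist_sq_lt_top _ _) ?_ ?_ hz hδ
    · rw [hmoment, hmoment, hdist0, ENNReal.ofReal_mul (ht0 k).le, mul_pow]
    · rw [hmoment, ← mul_pow, ← ENNReal.ofReal_mul (by linarith [ht1 k]), ← hσ, ← hdist1,
        ← edist_dist]
      exact W2cost_iteratedPullback_self hF k _ _
  have hball : ∀ n, 0 < (L (φ (n + N)) (β (t (φ (n + N))))).1 (Metric.ball p (2 * δ)) := fun n => by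
    refine (hannulus _ _ (hqpos (φ (n + N)))).trans_le (measure_mono fun x hx => ?_)
    rw [mem_ofPred_eq, abs_lt] at hx
    have h1 : dist p (q (φ (n + N))) < δ := by
      rw [dist_comm]
      exact hN (n + N) (by omega)
    have h2 := mul_le_of_le_one_left (dist_nonneg (x := p) (y := q (φ (n + N))))
      (ht1 (φ (n + N)))
    rw [Metric.mem_ball']
    linarith
  have hann : ∀ n, 0 < (L (φ (n + N)) (β (t (φ (n + N))))).1
      {x | |dist p x - 20 * δ| < δ} := fun n => by
    have h := hannulus _ _ (hrpos (φ (n + N)))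
    rwa [ht, div_mul_cancel₀ _ (hr0 _).ne'] at h
  obtain ⟨m, n, hmn, hlt⟩ := exists_ne_W2cost_lt_indepCost hδ
    (hRcomp.of_isClosed_subset Metric.isClosed_closedBall
      (Metric.closedBall_subset_closedBall hδR)) hball hann
  refine hlt.ne (W2cost_iteratedPullback_of_ne hF hFi (fun h => hmn ?_) _ _)
  have := hφ.injective h
  omega

lemma surjective_of_forall_map_dirac [LocallyCompactSpace A] [Nonempty A]
    (hB : IsGeodesicSpace B) {F : W2Space A ≃ W2Space B}
    (hF : ∀ μ ν, W2cost (F μ).1 (F ν).1 = W2cost μ.1 ν.1) {i : A → B} (hi : Isometry i)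
    (hFi : ∀ y, F (diracW2 y) = diracW2 (i y)) : Function.Surjective i := by
  by_contra hs
  have := hB.preconnectedSpace
  obtain ⟨y, hy⟩ := hi.exists_forall_exists_dist_lt hs
  obtain ⟨ρ, hρ, hcomp⟩ := Metric.exists_isCompact_closedBall y
  obtain ⟨w, hw, hyw⟩ := hy ρ hρ
  exact hw (mem_range_of_isCompact_closedBall hB hF hi hFi hcomp hyw)

lemma nonempty_isometryEquiv_of_W2Space_equiv [LocallyCompactSpace A] (hA : IsGeodesicSpace A)
    (hAc : GeodesicallyComplete A) (hB : IsGeodesicSpace B) {F : W2Space A ≃ W2Space B}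
    (hF : ∀ μ ν, W2cost (F μ).1 (F ν).1 = W2cost μ.1 ν.1) : Nonempty (A ≃ᵢ B) := by
  rcases isEmpty_or_nonempty A with hA' | hA'
  · have : IsEmpty B := ⟨fun z => by
      obtain ⟨x, -⟩ := (F.symm (diracW2 z)).2.2
      exact isEmptyElim x⟩
    exact ⟨⟨Equiv.equivOfIsEmpty A B, fun x => isEmptyElim x⟩⟩
  · obtain ⟨i, hi, hFi⟩ := exists_isometry_forall_map_dirac hA hAc hF
    exact ⟨⟨Equiv.ofBijective i ⟨hi.injective, surjective_of_forall_map_dirac hB hF hi hFi⟩, hi⟩⟩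

end Surjectivity

/-- **Statement 2.** For geodesic Polish spaces `Y`, `Z` with `Y` geodesically complete and
locally compact, the Wasserstein spaces `W₂(Y)` and `W₂(Z)` are isometric if and only if
`Y` and `Z` are isometric. -/
theorem wasserstein_isometric_iff (Y Z : Type*)
    [MetricSpace Y] [MeasurableSpace Y] [BorelSpace Y]
    [CompleteSpace Y] [TopologicalSpace.SeparableSpace Y]
    [MetricSpace Z] [MeasurableSpace Z] [BorelSpace Z]
    [CompleteSpace Z] [TopologicalSpace.SeparableSpace Z]
    (hY : IsGeodesicSpace Y) (hZ : IsGeodesicSpace Z)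
    (hYgc : GeodesicallyComplete Y) [LocallyCompactSpace Y] :
    (∃ F : W2Space Y ≃ W2Space Z, ∀ μ ν : W2Space Y, Wdist (F μ) (F ν) = Wdist μ ν) ↔
      Nonempty (Y ≃ᵢ Z) := by
  have := UniformSpace.secondCountable_of_separable Y
  have := UniformSpace.secondCountable_of_separable Z
  constructor
  · rintro ⟨F, hF⟩
    exact nonempty_isometryEquiv_of_W2Space_equiv hY hYgc hZ
      fun μ ν => (Wdist_eq_Wdist_iff _ _ _ _).1 (hF μ ν)
  · rintro ⟨e⟩
    exact exists_W2Space_equiv_of_isometryEquiv e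

end
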